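/- (Characterization of simulatable distributions for m = 2 via Borell's inequality.) Fix d ≥ 1 and 0 < ρ < 1. Let Φ(t) = ∫_{−∞}^t e^{−s²/2} ds/√(2π) and for a ∈ [0,1] let t_a ∈ [−∞,∞] satisfy Φ(t_a) = a. Then S_{ρ,2}(d) equals the set of matrices of the form [[c, a−c],[b−c, 1−a−b+c]] where a, b ∈ [0,1] and c ∈ ℝ satisfies ∫_ℝ 1_{(−t_a,∞)}(x) T_ρ 1_{(−∞,t_b)}(x) dγ_1(x) ≤ c ≤ ∫_ℝ 1_{(−∞,t_a)}(x) T_ρ 1_{(−∞,t_b)}(x) dγ_1(x). For −1 < ρ < 0, the same holds with the two inequalities on c reversed. -/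

import Mathlib

open MeasureTheory

noncomputable def gauss (d : ℕ) : Measure (EuclideanSpace ℝ (Fin d)) :=
  volume.withDensity (fun x => ENNReal.ofReal ((2 * Real.pi) ^ (-(d : ℝ) / 2) * Real.exp (-‖x‖ ^ 2 / 2)))

noncomputable def OU (d : ℕ) (ρ : ℝ) (f : EuclideanSpace ℝ (Fin d) → ℝ)
    (x : EuclideanSpace ℝ (Fin d)) : ℝ :=
  ∫ y, f (ρ • x + Real.sqrt (1 - ρ ^ 2) • y) ∂(gauss d)

noncomputable def Cmat (d m : ℕ) (ρ : ℝ)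
    (f g : EuclideanSpace ℝ (Fin d) → (Fin m → ℝ)) : Matrix (Fin m) (Fin m) ℝ :=
  Matrix.of fun i j => ∫ x, f x i * OU d ρ (fun y => g y j) x ∂(gauss d)

def SimplexMap (d m : ℕ) (f : EuclideanSpace ℝ (Fin d) → (Fin m → ℝ)) : Prop :=
  Measurable f ∧ ∀ x, f x ∈ stdSimplex ℝ (Fin m)

noncomputable def Sset (ρ : ℝ) (m d : ℕ) : Set (Matrix (Fin m) (Fin m) ℝ) :=
  { M | ∃ f g, SimplexMap d m f ∧ SimplexMap d m g ∧ M = Cmat d m ρ f g }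

/-- The standard Gaussian measure on `ℝ`. -/
noncomputable def gauss1R : Measure ℝ :=
  volume.withDensity (fun x => ENNReal.ofReal ((2 * Real.pi) ^ (-(1 : ℝ) / 2) * Real.exp (-x ^ 2 / 2)))

/-- The Ornstein–Uhlenbeck operator on functions on `ℝ`. -/
noncomputable def OU1 (ρ : ℝ) (f : ℝ → ℝ) (x : ℝ) : ℝ :=
  ∫ y, f (ρ * x + Real.sqrt (1 - ρ ^ 2) * y) ∂gauss1R

/-- The Gaussian cumulative distribution function, evaluated at an extended real `t`. -/
noncomputable def Phi (t : EReal) : ℝ :=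
  ∫ s in { x : ℝ | (x : EReal) < t }, Real.exp (-s ^ 2 / 2) / Real.sqrt (2 * Real.pi)

/-- The half-line `(−∞, t)`. -/
def lowerInt (t : EReal) : Set ℝ := { x : ℝ | (x : EReal) < t }

/-- The half-line `(−t, ∞)`. -/
def upperInt (t : EReal) : Set ℝ := { x : ℝ | -t < (x : EReal) }

/-- `∫ 1_{(−t_a,∞)} T_ρ 1_{(−∞,t_b)} dγ₁`. -/
noncomputable def borellLower (ρ : ℝ) (ta tb : EReal) : ℝ :=
  ∫ x, Set.indicator (upperInt ta) (fun _ => (1 : ℝ)) x *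
    OU1 ρ (Set.indicator (lowerInt tb) fun _ => (1 : ℝ)) x ∂gauss1R

/-- `∫ 1_{(−∞,t_a)} T_ρ 1_{(−∞,t_b)} dγ₁`. -/
noncomputable def borellUpper (ρ : ℝ) (ta tb : EReal) : ℝ :=
  ∫ x, Set.indicator (lowerInt ta) (fun _ => (1 : ℝ)) x *
    OU1 ρ (Set.indicator (lowerInt tb) fun _ => (1 : ℝ)) x ∂gauss1R

open ProbabilityTheory Set Filter Topology
open scoped NNReal ENNReal

local notation "γ" => gaussianReal 0 1

lemma gauss1R_eq : gauss1R = γ := by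
  rw [gauss1R, gaussianReal_of_var_ne_zero _ one_ne_zero]
  congr 1
  ext x
  rw [gaussianPDF, gaussianPDFReal]
  congr 2
  · rw [Real.sqrt_eq_rpow, ← Real.rpow_neg (by positivity)]
    norm_num
  · simp

lemma gauss_eq_stdGaussian (d : ℕ) : gauss d = stdGaussian (EuclideanSpace ℝ (Fin d)) := by
  have hconst : (0 : ℝ) < (2 * Real.pi) ^ (-(d : ℝ) / 2) := by positivity
  have hmeas : Measurable fun x : EuclideanSpace ℝ (Fin d) =>
      (2 * Real.pi) ^ (-(d : ℝ) / 2) * Real.exp (-‖x‖ ^ 2 / 2) := by fun_prop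
  have hint : Integrable fun x : EuclideanSpace ℝ (Fin d) =>
      (2 * Real.pi) ^ (-(d : ℝ) / 2) * Real.exp (-‖x‖ ^ 2 / 2) := by
    refine Integrable.const_mul ?_ _
    have := (GaussianFourier.integrable_cexp_neg_mul_sq_norm_add (V := EuclideanSpace ℝ (Fin d))
      (b := 1 / 2) (by norm_num) 0 0).norm
    refine this.congr (ae_of_all _ fun x => ?_)
    simp only [Complex.norm_exp]
    congr 1
    simp [← Complex.ofReal_pow]
    ring
  have : IsFiniteMeasure (gauss d) := by
    refine ⟨?_⟩
    rw [gauss, withDensity_apply _ MeasurableSet.univ, Measure.restrict_univ]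
    exact hint.lintegral_lt_top
  apply Measure.ext_of_charFun
  ext t
  rw [charFun_stdGaussian, charFun_apply, gauss,
    integral_withDensity_eq_integral_toReal_smul (by fun_prop) (by simp)]
  have key := GaussianFourier.integral_cexp_neg_mul_sq_norm_add (V := EuclideanSpace ℝ (Fin d))
      (b := 1 / 2) (by norm_num) Complex.I t
  have h1 : ∀ x : EuclideanSpace ℝ (Fin d),
      (ENNReal.ofReal ((2 * Real.pi) ^ (-(d : ℝ) / 2) * Real.exp (-‖x‖ ^ 2 / 2))).toReal •
        Complex.exp ((inner ℝ x t : ℝ) * Complex.I) =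
      ((2 * Real.pi) ^ (-(d : ℝ) / 2) : ℝ) *
        Complex.exp (-(1 / 2) * ‖x‖ ^ 2 + Complex.I * (inner ℝ t x : ℝ)) := by
    intro x
    rw [ENNReal.toReal_ofReal (by positivity), Complex.real_smul, Complex.ofReal_mul, mul_assoc,
      Complex.ofReal_exp, ← Complex.exp_add, real_inner_comm]
    congr 2
    push_cast
    ring
  simp_rw [h1]
  rw [integral_const_mul, key]
  have h2 : ((Real.pi : ℂ) / (1 / 2)) ^ ((Module.finrank ℝ (EuclideanSpace ℝ (Fin d)) : ℂ) / 2)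
      = (((2 * Real.pi) ^ ((d : ℝ) / 2) : ℝ) : ℂ) := by
    rw [Complex.ofReal_cpow (by positivity)]
    simp [mul_comm]
  rw [h2, ← mul_assoc, ← Complex.ofReal_mul, ← Real.rpow_add (by positivity)]
  rw [show -(d : ℝ) / 2 + d / 2 = 0 by ring]
  simp
  congr 1
  ring

instance (d : ℕ) : IsProbabilityMeasure (gauss d) := by
  rw [gauss_eq_stdGaussian]; infer_instance
/-- The Gaussian cumulative distribution function on `ℝ`. -/
noncomputable def gcdf (x : ℝ) : ℝ := (γ).real (Iio x)

/-- The standard Gaussian density on `ℝ`. -/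
noncomputable def gpdf (x : ℝ) : ℝ := (√(2 * Real.pi))⁻¹ * Real.exp (-x ^ 2 / 2)

lemma gpdf_eq : gpdf = gaussianPDFReal 0 1 := by
  ext x; simp [gpdf, gaussianPDFReal]

lemma gpdf_pos (x : ℝ) : 0 < gpdf x := by unfold gpdf; positivity

lemma contDiff_gpdf {n : WithTop ℕ∞} : ContDiff ℝ n gpdf := by
  unfold gpdf; fun_prop

lemma continuous_gpdf : Continuous gpdf := contDiff_gpdf (n := 0).continuous

lemma integrable_gpdf : Integrable gpdf := gpdf_eq ▸ integrable_gaussianPDFReal 0 1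

instance : NullSingletonClass γ := nullSingletonClass_gaussianReal one_ne_zero

lemma measureReal_gaussian (s : Set ℝ) : (γ).real s = ∫ x in s, gpdf x := by
  rw [measureReal_def, gaussianReal_apply_eq_integral _ one_ne_zero, gpdf_eq,
    ENNReal.toReal_ofReal (integral_nonneg fun x => gaussianPDFReal_nonneg _ _ _)]

lemma gcdf_sub (x y : ℝ) : gcdf y - gcdf x = ∫ t in x..y, gpdf t := by
  rw [gcdf, gcdf, measureReal_gaussian, measureReal_gaussian, ← integral_Iic_eq_integral_Iio,
    ← integral_Iic_eq_integral_Iio,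
    intervalIntegral.integral_Iic_sub_Iic integrable_gpdf.integrableOn integrable_gpdf.integrableOn]

lemma hasStrictDerivAt_gcdf (x : ℝ) : HasStrictDerivAt gcdf (gpdf x) x := by
  have h := (continuous_gpdf.integral_hasStrictDerivAt 0 x).add_const (gcdf 0)
  have e : gcdf = fun y => (∫ t in (0 : ℝ)..y, gpdf t) + gcdf 0 := by
    ext y
    rw [← gcdf_sub]; ring
  rw [e]
  exact h

lemma continuous_gcdf : Continuous gcdf :=
  continuous_iff_continuousAt.2 fun x => (hasStrictDerivAt_gcdf x).hasDerivAt.continuousAt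

lemma strictMono_gcdf : StrictMono gcdf :=
  strictMono_of_hasDerivAt_pos (fun x => (hasStrictDerivAt_gcdf x).hasDerivAt) gpdf_pos

lemma gcdf_neg (x : ℝ) : gcdf (-x) = 1 - gcdf x := by
  have h : (γ).map (fun x => -x) = γ := by rw [gaussianReal_map_neg, neg_zero]
  have h1 : gcdf (-x) = (γ).real (Ioi x) := by
    rw [gcdf]
    nth_rewrite 1 [← h]
    rw [map_measureReal_apply measurable_neg measurableSet_Iio]
    congr 1
    ext y
    simp
  rw [h1, gcdf, ← probReal_compl_eq_one_sub measurableSet_Iio, compl_Iio]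
  exact measureReal_congr Ioi_ae_eq_Ici

lemma tendsto_gcdf_atTop : Tendsto gcdf atTop (𝓝 1) := by
  have h := tendsto_cdf_atTop γ
  refine h.congr fun x => ?_
  rw [cdf_eq_real, gcdf]
  exact measureReal_congr Iio_ae_eq_Iic.symm

lemma tendsto_gcdf_atBot : Tendsto gcdf atBot (𝓝 0) := by
  have h := tendsto_cdf_atBot γ
  refine h.congr fun x => ?_
  rw [cdf_eq_real, gcdf]
  exact measureReal_congr Iio_ae_eq_Iic.symm

lemma gcdf_pos (x : ℝ) : 0 < gcdf x :=
  (measureReal_nonneg : 0 ≤ gcdf (x - 1)).trans_lt (strictMono_gcdf (by linarith))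

lemma gcdf_lt_one (x : ℝ) : gcdf x < 1 := by
  have := gcdf_pos (-x)
  rw [gcdf_neg] at this
  linarith

lemma exists_gcdf_eq {a : ℝ} (ha : a ∈ Ioo (0 : ℝ) 1) : ∃ x, gcdf x = a := by
  obtain ⟨x, hx⟩ := (tendsto_gcdf_atBot.eventually (gt_mem_nhds ha.1)).exists
  obtain ⟨y, hy⟩ := (tendsto_gcdf_atTop.eventually (lt_mem_nhds ha.2)).exists
  exact mem_range_of_exists_le_of_exists_ge continuous_gcdf ⟨x, hx.le⟩ ⟨y, hy.le⟩

lemma measureReal_gcdf_lt (a : ℝ) : (γ).real {x | gcdf x < a} = max 0 (min a 1) := by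
  rcases le_or_gt a 0 with h0 | h0
  · have : {x | gcdf x < a} = ∅ := by
      ext x; simpa using h0.trans (gcdf_pos x).le
    rw [this, measureReal_empty, max_eq_left ((min_le_left _ _).trans h0)]
  rcases le_or_gt 1 a with h1 | h1
  · have : {x | gcdf x < a} = univ := by
      ext x; simpa using (gcdf_lt_one x).trans_le h1
    rw [this, probReal_univ, min_eq_right h1, max_eq_right zero_le_one]
  obtain ⟨x, rfl⟩ := exists_gcdf_eq ⟨h0, h1⟩
  simp only [strictMono_gcdf.lt_iff_lt]
  rw [min_eq_left h1.le, max_eq_right h0.le]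
  rfl

lemma measurable_gcdf : Measurable gcdf := continuous_gcdf.measurable

lemma measurableSet_lowerInt (t : EReal) : MeasurableSet (lowerInt t) :=
  measurableSet_lt measurable_coe_real_ereal measurable_const

lemma Phi_eq (t : EReal) : Phi t = (γ).real (lowerInt t) := by
  rw [Phi, measureReal_gaussian, lowerInt]
  congr 1
  ext s
  rw [gpdf, div_eq_inv_mul]

lemma lowerInt_coe (x : ℝ) : lowerInt x = Iio x := by ext; simp [lowerInt]
lemma lowerInt_bot : lowerInt ⊥ = ∅ := by ext; simp [lowerInt]
lemma lowerInt_top : lowerInt ⊤ = univ := by ext; simp [lowerInt, EReal.coe_lt_top]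

/-- The half-line `(−∞, t)` is a sublevel set of the distribution function. -/
lemma lowerInt_eq (t : EReal) : lowerInt t = {x | gcdf x < Phi t} := by
  rw [Phi_eq]
  induction t with
  | bot => ext x; simp [lowerInt_bot, (gcdf_pos x).le]
  | top => ext x; simp [lowerInt_top, gcdf_lt_one x]
  | coe y =>
    rw [lowerInt_coe]
    ext x
    exact strictMono_gcdf.lt_iff_lt.symm

lemma exists_Phi_eq {a : ℝ} (ha : a ∈ Icc (0 : ℝ) 1) : ∃ t, Phi t = a := by
  rcases ha.1.eq_or_lt with rfl | h0
  · exact ⟨⊥, by simp [Phi_eq, lowerInt_bot]⟩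
  rcases ha.2.eq_or_lt with rfl | h1
  · exact ⟨⊤, by simp [Phi_eq, lowerInt_top]⟩
  obtain ⟨x, rfl⟩ := exists_gcdf_eq ⟨h0, h1⟩
  exact ⟨x, by rw [Phi_eq, lowerInt_coe, gcdf]⟩

/-- The half-line `(−t, ∞)` is a superlevel set of the distribution function. -/
lemma upperInt_eq (t : EReal) : upperInt t = {x | 1 - Phi t < gcdf x} := by
  ext x
  have h : x ∈ upperInt t ↔ -x ∈ lowerInt t := by
    simp only [upperInt, lowerInt, mem_ofPred_eq, EReal.coe_neg]
    exact EReal.neg_lt_comm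
  rw [h, lowerInt_eq, mem_ofPred_eq, mem_ofPred_eq, gcdf_neg, sub_lt_comm]
/-- The half-line noise stability as a function of the Gaussian measures of the half-lines. -/
noncomputable def bstab (ρ a b : ℝ) : ℝ :=
  ((γ).prod γ).real {p | gcdf p.1 < a ∧ gcdf (ρ * p.1 + √(1 - ρ ^ 2) * p.2) < b}

lemma map_correlated {ρ : ℝ} (hρ : ρ ^ 2 ≤ 1) (v : ℝ≥0) :
    ((gaussianReal 0 v).prod (gaussianReal 0 v)).map
      (fun p : ℝ × ℝ => ρ * p.1 + √(1 - ρ ^ 2) * p.2) = gaussianReal 0 v := by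
  have h1 : (fun p : ℝ × ℝ => ρ * p.1 + √(1 - ρ ^ 2) * p.2) =
      (fun p : ℝ × ℝ => p.1 + p.2) ∘ Prod.map (ρ * ·) (√(1 - ρ ^ 2) * ·) := rfl
  rw [h1, ← Measure.map_map (by fun_prop) (by fun_prop),
    ← Measure.map_prod_map _ _ (by fun_prop) (by fun_prop), gaussianReal_map_const_mul,
    gaussianReal_map_const_mul]
  change (gaussianReal _ _) ∗ (gaussianReal _ _) = _
  rw [gaussianReal_conv_gaussianReal]
  congr 1
  · simp
  · ext
    simp [Real.sq_sqrt (sub_nonneg.2 hρ)]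
    ring

lemma measurableSet_gcdf_lt (a : ℝ) : MeasurableSet {x | gcdf x < a} :=
  measurableSet_lt measurable_gcdf measurable_const

lemma measureReal_correlated {ρ : ℝ} (hρ : ρ ^ 2 ≤ 1) {s : Set ℝ} (hs : MeasurableSet s) :
    ((γ).prod γ).real {p | ρ * p.1 + √(1 - ρ ^ 2) * p.2 ∈ s} = (γ).real s := by
  conv_rhs => rw [← map_correlated hρ 1]
  rw [map_measureReal_apply (by fun_prop) hs]
  rfl

lemma measurableSet_bstab (ρ a b : ℝ) :
    MeasurableSet {p : ℝ × ℝ | gcdf p.1 < a ∧ gcdf (ρ * p.1 + √(1 - ρ ^ 2) * p.2) < b} :=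
  (measurableSet_lt (measurable_gcdf.comp measurable_fst) measurable_const).inter
    (measurableSet_lt (measurable_gcdf.comp (by fun_prop)) measurable_const)

lemma measureReal_diff_gcdf {a a' : ℝ} (h : a ≤ a') :
    (γ).real {x | gcdf x < a' ∧ ¬ gcdf x < a} ≤ a' - a := by
  have : {x | gcdf x < a' ∧ ¬ gcdf x < a} = {x | gcdf x < a'} \ {x | gcdf x < a} := rfl
  have hsub : {x | gcdf x < a} ⊆ {x | gcdf x < a'} := fun x hx => lt_of_lt_of_le hx h
  rw [this, measureReal_sdiff hsub (measurableSet_gcdf_lt a),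
    measureReal_gcdf_lt, measureReal_gcdf_lt]
  rcases le_total a 1 with h1 | h1 <;> rcases le_total a' 1 with h2 | h2 <;>
    rcases le_total a 0 with h3 | h3 <;> rcases le_total a' 0 with h4 | h4 <;>
    simp [*] <;> linarith

lemma bstab_le_left {ρ : ℝ} (a a' b : ℝ) : bstab ρ a' b ≤ bstab ρ a b + |a' - a| := by
  rcases le_total a a' with h | h
  · have h1 : bstab ρ a' b ≤ bstab ρ a b +
        ((γ).prod γ).real {p | gcdf p.1 < a' ∧ ¬ gcdf p.1 < a} := by
      refine (measureReal_mono ?_).trans (measureReal_union_le _ _)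
      rintro p ⟨hp1, hp2⟩
      by_cases hp : gcdf p.1 < a
      exacts [Or.inl ⟨hp, hp2⟩, Or.inr ⟨hp1, hp⟩]
    have h2 : ((γ).prod γ).real {p | gcdf p.1 < a' ∧ ¬ gcdf p.1 < a} =
        (γ).real {x | gcdf x < a' ∧ ¬ gcdf x < a} := by
      rw [← (measurePreserving_fst (μ := γ) (ν := γ)).measureReal_preimage]
      · rfl
      · exact ((measurableSet_gcdf_lt a').inter (measurableSet_gcdf_lt a).compl).nullMeasurableSet
    have h3 := measureReal_diff_gcdf h
    rw [abs_of_nonneg (sub_nonneg.2 h)]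
    linarith
  · refine (measureReal_mono ?_).trans (le_add_of_nonneg_right (abs_nonneg _))
    rintro p ⟨hp1, hp2⟩
    exact ⟨hp1.trans_le h, hp2⟩

lemma bstab_le_right {ρ : ℝ} (hρ : ρ ^ 2 ≤ 1) (a b b' : ℝ) :
    bstab ρ a b' ≤ bstab ρ a b + |b' - b| := by
  rcases le_total b b' with h | h
  · have h1 : bstab ρ a b' ≤ bstab ρ a b + ((γ).prod γ).real
        {p | ρ * p.1 + √(1 - ρ ^ 2) * p.2 ∈ {x | gcdf x < b' ∧ ¬ gcdf x < b}} := by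
      refine (measureReal_mono ?_).trans (measureReal_union_le _ _)
      rintro p ⟨hp1, hp2⟩
      by_cases hp : gcdf (ρ * p.1 + √(1 - ρ ^ 2) * p.2) < b
      exacts [Or.inl ⟨hp1, hp⟩, Or.inr ⟨hp2, hp⟩]
    have hm : MeasurableSet {x | gcdf x < b' ∧ ¬ gcdf x < b} :=
      (measurableSet_gcdf_lt b').inter (measurableSet_gcdf_lt b).compl
    rw [measureReal_correlated hρ hm] at h1
    have h3 := measureReal_diff_gcdf h
    rw [abs_of_nonneg (sub_nonneg.2 h)]
    linarith
  · refine (measureReal_mono ?_).trans (le_add_of_nonneg_right (abs_nonneg _))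
    rintro p ⟨hp1, hp2⟩
    exact ⟨hp1, hp2.trans_le h⟩

lemma bstab_le {ρ : ℝ} (hρ : ρ ^ 2 ≤ 1) (a b a' b' : ℝ) :
    bstab ρ a' b' ≤ bstab ρ a b + (|a' - a| + |b' - b|) := by
  linarith [bstab_le_left (ρ := ρ) a a' b', bstab_le_right hρ a b b']

lemma bstab_nonneg (ρ a b : ℝ) : 0 ≤ bstab ρ a b := measureReal_nonneg

lemma bstab_le_one (ρ a b : ℝ) : bstab ρ a b ≤ 1 := measureReal_le_one

lemma continuous_bstab {ρ : ℝ} (hρ : ρ ^ 2 ≤ 1) :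
    Continuous fun p : ℝ × ℝ => bstab ρ p.1 p.2 := by
  refine (LipschitzWith.of_dist_le_mul (K := 2) fun p p' => ?_).continuous
  have h1 := bstab_le hρ p'.1 p'.2 p.1 p.2
  have h2 := bstab_le hρ p.1 p.2 p'.1 p'.2
  have h3 : |p.1 - p'.1| ≤ dist p p' := le_max_left (dist p.1 p'.1) (dist p.2 p'.2)
  have h4 : |p.2 - p'.2| ≤ dist p p' := le_max_right (dist p.1 p'.1) (dist p.2 p'.2)
  rw [abs_sub_comm p'.1, abs_sub_comm p'.2] at h2
  rw [Real.dist_eq, abs_le, NNReal.coe_ofNat]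
  constructor <;> linarith

lemma integrable_of_mem_Icc {α : Type*} [MeasurableSpace α] {μ : Measure α} [IsFiniteMeasure μ]
    {f : α → ℝ} (hf : Measurable f) (h : ∀ x, f x ∈ Icc (0 : ℝ) 1) : Integrable f μ :=
  .of_bound hf.aestronglyMeasurable 1 (ae_of_all _ fun x => by
    rw [Real.norm_eq_abs, abs_of_nonneg (h x).1]; exact (h x).2)

lemma integral_mem_Icc {α : Type*} [MeasurableSpace α] {μ : Measure α} [IsProbabilityMeasure μ]
    {f : α → ℝ} (hf : Measurable f) (h : ∀ x, f x ∈ Icc (0 : ℝ) 1) :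
    ∫ x, f x ∂μ ∈ Icc (0 : ℝ) 1 := by
  refine ⟨integral_nonneg fun x => (h x).1, ?_⟩
  calc ∫ x, f x ∂μ ≤ ∫ x, (1 : ℝ) ∂μ :=
        integral_mono (integrable_of_mem_Icc hf h) (integrable_const _) fun x => (h x).2
    _ = 1 := by simp

/-- The joint density of a correlated pair of standard Gaussians. -/
noncomputable def gkernel (ρ x y : ℝ) : ℝ :=
  gpdf x * (gpdf ((y - ρ * x) / √(1 - ρ ^ 2)) / √(1 - ρ ^ 2))

lemma sqrt_one_sub_pos {ρ : ℝ} (hρ : ρ ^ 2 < 1) : 0 < √(1 - ρ ^ 2) := Real.sqrt_pos.2 (by linarith)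

lemma gpdf_mul_gpdf_comm {ρ : ℝ} (hρ : ρ ^ 2 < 1) (x y : ℝ) :
    gpdf x * gpdf ((y - ρ * x) / √(1 - ρ ^ 2)) = gpdf y * gpdf ((x - ρ * y) / √(1 - ρ ^ 2)) := by
  have hs : √(1 - ρ ^ 2) ^ 2 = 1 - ρ ^ 2 := Real.sq_sqrt (by linarith)
  have h0 : 1 - ρ ^ 2 ≠ 0 := by linarith
  simp only [gpdf]
  rw [mul_mul_mul_comm, mul_mul_mul_comm _ (Real.exp (-y ^ 2 / 2)), ← Real.exp_add, ← Real.exp_add,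
    div_pow, div_pow, hs]
  congr 2
  field_simp
  ring

lemma gkernel_comm {ρ : ℝ} (hρ : ρ ^ 2 < 1) (x y : ℝ) : gkernel ρ x y = gkernel ρ y x := by
  unfold gkernel
  rw [← mul_div_assoc, ← mul_div_assoc, gpdf_mul_gpdf_comm hρ]

lemma gcdf_affine_eq {ρ : ℝ} (hρ : ρ ^ 2 < 1) (x t : ℝ) :
    gcdf ((t - ρ * x) / √(1 - ρ ^ 2)) =
      ∫ y in Iio t, gpdf ((y - ρ * x) / √(1 - ρ ^ 2)) / √(1 - ρ ^ 2) := by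
  have hs := sqrt_one_sub_pos hρ
  have hmap : (γ).map (fun y => ρ * x + √(1 - ρ ^ 2) * y) =
      gaussianReal (ρ * x) (NNReal.mk (√(1 - ρ ^ 2) ^ 2) (sq_nonneg _)) := by
    have : (fun y => ρ * x + √(1 - ρ ^ 2) * y) = (ρ * x + ·) ∘ (√(1 - ρ ^ 2) * ·) := rfl
    rw [this, ← Measure.map_map (by fun_prop) (by fun_prop), gaussianReal_map_const_mul,
      gaussianReal_map_const_add]
    simp
  have hv : NNReal.mk (√(1 - ρ ^ 2) ^ 2) (sq_nonneg _) ≠ 0 := by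
    rw [Ne, ← NNReal.coe_inj]; exact (pow_pos hs 2).ne'
  calc gcdf ((t - ρ * x) / √(1 - ρ ^ 2))
      = ((γ).map (fun y => ρ * x + √(1 - ρ ^ 2) * y)).real (Iio t) := by
        rw [map_measureReal_apply (by fun_prop) measurableSet_Iio, gcdf]
        congr 1
        ext y
        rw [mem_Iio, mem_preimage, mem_Iio, lt_div_iff₀ hs, ← lt_sub_iff_add_lt', mul_comm]
    _ = _ := by
        rw [hmap, measureReal_def, gaussianReal_apply_eq_integral _ hv,
          ENNReal.toReal_ofReal (integral_nonneg fun x => gaussianPDFReal_nonneg _ _ _)]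
        congr 1
        ext y
        simp only [gaussianPDFReal, gpdf]
        rw [NNReal.coe_mk, Real.sqrt_mul' _ (sq_nonneg _), Real.sqrt_sq hs.le, div_pow, mul_inv]
        rw [show -((y - ρ * x) ^ 2 / √(1 - ρ ^ 2) ^ 2) / 2 =
          -(y - ρ * x) ^ 2 / (2 * √(1 - ρ ^ 2) ^ 2) by field_simp]
        ring

lemma bstab_gcdf_eq_setIntegral {ρ : ℝ} (hρ : ρ ^ 2 < 1) (s t : ℝ) :
    bstab ρ (gcdf s) (gcdf t) =
      ∫ x in Iio s, gpdf x * gcdf ((t - ρ * x) / √(1 - ρ ^ 2)) := by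
  have hs := sqrt_one_sub_pos hρ
  rw [bstab, measureReal_def, Measure.prod_apply (measurableSet_bstab _ _ _)]
  have h1 : ∀ x, γ (Prod.mk x ⁻¹' {p : ℝ × ℝ | gcdf p.1 < gcdf s ∧
      gcdf (ρ * p.1 + √(1 - ρ ^ 2) * p.2) < gcdf t}) =
      (Iio s).indicator (fun x => ENNReal.ofReal (gcdf ((t - ρ * x) / √(1 - ρ ^ 2)))) x := by
    intro x
    simp only [strictMono_gcdf.lt_iff_lt]
    by_cases hx : x < s
    · rw [indicator_of_mem (mem_Iio.2 hx), gcdf, ofReal_measureReal]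
      congr 1
      ext y
      simp only [mem_preimage, mem_ofPred_eq, hx, true_and, mem_Iio]
      rw [lt_div_iff₀ hs, ← lt_sub_iff_add_lt', mul_comm]
    · rw [indicator_of_notMem (by simpa using hx)]
      simp [hx]
  simp_rw [h1]
  rw [lintegral_indicator measurableSet_Iio, ← integral_eq_lintegral_of_nonneg_ae
    (ae_of_all _ fun x => (gcdf_pos _).le)
    (measurable_gcdf.comp (by fun_prop)).aestronglyMeasurable, ← integral_indicator
    measurableSet_Iio, integral_gaussianReal_eq_integral_smul one_ne_zero,
    ← integral_indicator measurableSet_Iio]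
  congr 1
  ext x
  rw [← gpdf_eq]
  by_cases hx : x < s <;> simp [indicator, hx]

lemma bstab_gcdf_eq_integral_gkernel {ρ : ℝ} (hρ : ρ ^ 2 < 1) (s t : ℝ) :
    bstab ρ (gcdf s) (gcdf t) = ∫ x in Iio s, ∫ y in Iio t, gkernel ρ x y := by
  rw [bstab_gcdf_eq_setIntegral hρ]
  congr 1
  ext x
  rw [gcdf_affine_eq hρ]
  unfold gkernel
  rw [integral_const_mul]

lemma integrable_gkernel {ρ : ℝ} (hρ : ρ ^ 2 < 1) :
    Integrable (fun p : ℝ × ℝ => gkernel ρ p.1 p.2) := by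
  have hs := sqrt_one_sub_pos hρ
  have hint : ∀ x : ℝ, Integrable
      (fun y => gpdf ((y - ρ * x) / √(1 - ρ ^ 2)) / √(1 - ρ ^ 2)) := fun x =>
    ((integrable_gpdf.comp_div hs.ne').comp_sub_right (ρ * x)).div_const _
  have hone : ∫ y, gpdf y = 1 := by
    rw [gpdf_eq]; exact integral_gaussianPDFReal_eq_one 0 one_ne_zero
  rw [Measure.volume_eq_prod, integrable_prod_iff]
  · refine ⟨ae_of_all _ fun x => ?_, ?_⟩
    · simpa only [gkernel] using (hint x).const_mul (gpdf x)
    refine integrable_gpdf.congr (ae_of_all _ fun x => ?_)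
    have hnorm : ∀ y, ‖gkernel ρ x y‖ =
        gpdf x * (gpdf ((y - ρ * x) / √(1 - ρ ^ 2)) / √(1 - ρ ^ 2)) := fun y => by
      rw [Real.norm_eq_abs, abs_of_nonneg, gkernel]
      exact mul_nonneg (gpdf_pos _).le (div_nonneg (gpdf_pos _).le hs.le)
    simp only [hnorm]
    rw [integral_const_mul, integral_div,
      integral_sub_right_eq_self (fun y => gpdf (y / √(1 - ρ ^ 2))) (ρ * x),
      Measure.integral_comp_div, hone, abs_of_pos hs]
    simp [hs.ne']
  · refine Continuous.aestronglyMeasurable ?_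
    unfold gkernel
    have := continuous_gpdf
    fun_prop

lemma bstab_gcdf_comm {ρ : ℝ} (hρ : ρ ^ 2 < 1) (s t : ℝ) :
    bstab ρ (gcdf s) (gcdf t) = bstab ρ (gcdf t) (gcdf s) := by
  rw [bstab_gcdf_eq_integral_gkernel hρ, bstab_gcdf_eq_integral_gkernel hρ, integral_integral_swap]
  · simp_rw [gkernel_comm hρ]
  · rw [Measure.prod_restrict]
    exact (integrable_gkernel hρ).integrableOn

lemma bstab_comm {ρ : ℝ} (hρ : ρ ^ 2 < 1) {a b : ℝ} (ha : a ∈ Ioo (0 : ℝ) 1)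
    (hb : b ∈ Ioo (0 : ℝ) 1) : bstab ρ a b = bstab ρ b a := by
  obtain ⟨s, rfl⟩ := exists_gcdf_eq ha
  obtain ⟨t, rfl⟩ := exists_gcdf_eq hb
  exact bstab_gcdf_comm hρ s t

/-- The Gaussian quantile function. -/
noncomputable def gquant : ℝ → ℝ := Function.invFun gcdf

lemma gquant_gcdf (x : ℝ) : gquant (gcdf x) = x :=
  Function.leftInverse_invFun strictMono_gcdf.injective x

lemma gcdf_gquant {a : ℝ} (ha : a ∈ Ioo (0 : ℝ) 1) : gcdf (gquant a) = a :=
  Function.invFun_eq (exists_gcdf_eq ha)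

lemma hasDerivAt_gquant {a : ℝ} (ha : a ∈ Ioo (0 : ℝ) 1) :
    HasDerivAt gquant (gpdf (gquant a))⁻¹ a := by
  have h := (hasStrictDerivAt_gcdf (gquant a)).to_local_left_inverse (gpdf_pos _).ne'
    (Eventually.of_forall gquant_gcdf)
  rw [gcdf_gquant ha] at h
  exact h.hasDerivAt

lemma contDiffOn_gquant : ContDiffOn ℝ 1 gquant (Ioo 0 1) := by
  have hc : ContinuousOn gquant (Ioo 0 1) := fun a ha =>
    (hasDerivAt_gquant ha).continuousAt.continuousWithinAt
  have h1 : ContDiffOn ℝ (0 + 1) gquant (Ioo 0 1) := by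
    rw [contDiffOn_succ_iff_deriv_of_isOpen isOpen_Ioo]
    refine ⟨fun a ha => (hasDerivAt_gquant ha).differentiableAt.differentiableWithinAt, by simp, ?_⟩
    rw [contDiffOn_zero]
    refine ContinuousOn.congr (f := fun a => (gpdf (gquant a))⁻¹) ?_
      fun a ha => (hasDerivAt_gquant ha).deriv
    exact (continuous_gpdf.comp_continuousOn hc).inv₀ fun a _ => (gpdf_pos _).ne'
  simpa using h1

lemma contDiffAt_gquant {a : ℝ} (ha : a ∈ Ioo (0 : ℝ) 1) : ContDiffAt ℝ 1 gquant a :=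
  contDiffOn_gquant.contDiffAt (isOpen_Ioo.mem_nhds ha)

/-- The first partial derivative of `bstab ρ` in its first argument. -/
noncomputable def bstabD (ρ a b : ℝ) : ℝ := gcdf ((gquant b - ρ * gquant a) / √(1 - ρ ^ 2))

/-- The second partial derivative of `bstab ρ` in its first argument. -/
noncomputable def bstabDD (ρ a b : ℝ) : ℝ :=
  gpdf ((gquant b - ρ * gquant a) / √(1 - ρ ^ 2)) *
    (-(ρ * (gpdf (gquant a))⁻¹) / √(1 - ρ ^ 2))

/-- The mixed second partial derivative of `bstab ρ`. -/
noncomputable def bstabDM (ρ a b : ℝ) : ℝ :=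
  gpdf ((gquant b - ρ * gquant a) / √(1 - ρ ^ 2)) * ((gpdf (gquant b))⁻¹ / √(1 - ρ ^ 2))

lemma hasDerivAt_bstab_gcdf {ρ : ℝ} (hρ : ρ ^ 2 < 1) (s t : ℝ) :
    HasDerivAt (fun s => bstab ρ (gcdf s) (gcdf t))
      (gpdf s * gcdf ((t - ρ * s) / √(1 - ρ ^ 2))) s := by
  have hcont : Continuous fun x => gpdf x * gcdf ((t - ρ * x) / √(1 - ρ ^ 2)) :=
    continuous_gpdf.mul (continuous_gcdf.comp (by fun_prop))
  have hint : Integrable fun x => gpdf x * gcdf ((t - ρ * x) / √(1 - ρ ^ 2)) := by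
    refine integrable_gpdf.mono hcont.aestronglyMeasurable (ae_of_all _ fun x => ?_)
    rw [norm_mul]
    refine mul_le_of_le_one_right (norm_nonneg _) ?_
    rw [Real.norm_eq_abs, abs_of_pos (gcdf_pos _)]
    exact (gcdf_lt_one _).le
  have h := (hcont.integral_hasStrictDerivAt 0 s).hasDerivAt.add_const
    (bstab ρ (gcdf 0) (gcdf t))
  have e : (fun s => bstab ρ (gcdf s) (gcdf t)) = fun s =>
      (∫ x in (0 : ℝ)..s, gpdf x * gcdf ((t - ρ * x) / √(1 - ρ ^ 2))) +
        bstab ρ (gcdf 0) (gcdf t) := by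
    ext y
    rw [bstab_gcdf_eq_setIntegral hρ, bstab_gcdf_eq_setIntegral hρ, ← integral_Iic_eq_integral_Iio,
      ← integral_Iic_eq_integral_Iio,
      ← intervalIntegral.integral_Iic_sub_Iic hint.integrableOn hint.integrableOn]
    ring
  rw [e]
  exact h

lemma hasDerivAt_bstab {ρ : ℝ} (hρ : ρ ^ 2 < 1) {a b : ℝ} (ha : a ∈ Ioo (0 : ℝ) 1)
    (hb : b ∈ Ioo (0 : ℝ) 1) : HasDerivAt (fun a => bstab ρ a b) (bstabD ρ a b) a := by
  have h := (hasDerivAt_bstab_gcdf hρ (gquant a) (gquant b)).comp a (hasDerivAt_gquant ha)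
  rw [mul_right_comm, mul_inv_cancel₀ (gpdf_pos _).ne', one_mul] at h
  refine h.congr_of_eventuallyEq ?_
  filter_upwards [isOpen_Ioo.mem_nhds ha] with x hx
  simp [gcdf_gquant hx, gcdf_gquant hb]

lemma hasDerivAt_bstabD_left {ρ : ℝ} {a b : ℝ} (ha : a ∈ Ioo (0 : ℝ) 1) :
    HasDerivAt (fun a => bstabD ρ a b) (bstabDD ρ a b) a := by
  have h : HasDerivAt (fun a => (gquant b - ρ * gquant a) / √(1 - ρ ^ 2))
      (-(ρ * (gpdf (gquant a))⁻¹) / √(1 - ρ ^ 2)) a :=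
    (((hasDerivAt_gquant ha).const_mul ρ).const_sub (gquant b)).div_const _
  exact (hasStrictDerivAt_gcdf _).hasDerivAt.comp a h

lemma hasDerivAt_bstabD_right {ρ : ℝ} {a b : ℝ} (hb : b ∈ Ioo (0 : ℝ) 1) :
    HasDerivAt (fun b => bstabD ρ a b) (bstabDM ρ a b) b := by
  have h : HasDerivAt (fun b => (gquant b - ρ * gquant a) / √(1 - ρ ^ 2))
      ((gpdf (gquant b))⁻¹ / √(1 - ρ ^ 2)) b :=
    ((hasDerivAt_gquant hb).sub_const (ρ * gquant a)).div_const _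
  exact (hasStrictDerivAt_gcdf _).hasDerivAt.comp b h

/-- The second-order form governing the evolution of `bstab` along correlated Gaussians is
negative semidefinite. -/
lemma bstab_form_nonpos {ρ : ℝ} (h0 : 0 ≤ ρ) (h1 : ρ < 1) (a b p r : ℝ) :
    bstabDD ρ a b * p ^ 2 + 2 * ρ * bstabDM ρ a b * p * r + bstabDD ρ b a * r ^ 2 ≤ 0 := by
  have hρ : ρ ^ 2 < 1 := by nlinarith
  have hs := sqrt_one_sub_pos hρ
  have hsym := gpdf_mul_gpdf_comm hρ (gquant a) (gquant b)
  have ha := gpdf_pos (gquant a)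
  have hb := gpdf_pos (gquant b)
  have hK := gpdf_pos ((gquant b - ρ * gquant a) / √(1 - ρ ^ 2))
  unfold bstabDD bstabDM
  rw [mul_comm (gpdf (gquant b)), ← div_eq_iff hb.ne'] at hsym
  rw [← hsym]
  have : gpdf ((gquant b - ρ * gquant a) / √(1 - ρ ^ 2)) *
        (-(ρ * (gpdf (gquant a))⁻¹) / √(1 - ρ ^ 2)) * p ^ 2 +
      2 * ρ * (gpdf ((gquant b - ρ * gquant a) / √(1 - ρ ^ 2)) *
        ((gpdf (gquant b))⁻¹ / √(1 - ρ ^ 2))) * p * r +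
      gpdf (gquant a) * gpdf ((gquant b - ρ * gquant a) / √(1 - ρ ^ 2)) / gpdf (gquant b) *
        (-(ρ * (gpdf (gquant b))⁻¹) / √(1 - ρ ^ 2)) * r ^ 2 =
      -(ρ * gpdf ((gquant b - ρ * gquant a) / √(1 - ρ ^ 2)) * gpdf (gquant a) / √(1 - ρ ^ 2) *
        (p / gpdf (gquant a) - r / gpdf (gquant b)) ^ 2) := by
    field_simp
    ring
  rw [this, neg_nonpos]
  positivity
lemma abs_sub_sub_le_of_lipschitz_deriv {F F' : ℝ → ℝ} {l u K : ℝ} (h0 : 0 ≤ K)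
    (hF : ∀ x ∈ Icc l u, HasDerivAt F (F' x) x)
    (hK : ∀ x ∈ Icc l u, ∀ y ∈ Icc l u, |F' x - F' y| ≤ K * |x - y|)
    {x y : ℝ} (hx : x ∈ Icc l u) (hy : y ∈ Icc l u) :
    |F y - F x - F' x * (y - x)| ≤ K * |y - x| ^ 2 := by
  have hsub : uIcc x y ⊆ Icc l u := uIcc_subset_Icc hx hy
  have h := (convex_uIcc x y).norm_image_sub_le_of_norm_hasDerivWithin_le
    (f := fun z => F z - F' x * z) (f' := fun z => F' z - F' x) (C := K * |y - x|)
    (fun z hz => by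
      have := ((hF z (hsub hz)).sub ((hasDerivAt_id z).const_mul (F' x)))
      simp only [mul_one] at this
      exact this.hasDerivWithinAt)
    (fun z hz => by
      have h1 := hK z (hsub hz) x hx
      have h2 : |z - x| ≤ |y - x| := abs_sub_left_of_mem_uIcc hz
      rw [Real.norm_eq_abs]
      nlinarith) left_mem_uIcc right_mem_uIcc
  rw [Real.norm_eq_abs, Real.norm_eq_abs] at h
  rw [show F y - F x - F' x * (y - x) = F y - F' x * y - (F x - F' x * x) by ring]
  linarith [h, sq |y - x|]

lemma taylor_two_le {F F' F₂ : ℝ → ℝ} {l u K : ℝ} (h0 : 0 ≤ K)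
    (hF : ∀ x ∈ Icc l u, HasDerivAt F (F' x) x) (hF' : ∀ x ∈ Icc l u, HasDerivAt F' (F₂ x) x)
    (hK : ∀ x ∈ Icc l u, ∀ y ∈ Icc l u, |F₂ x - F₂ y| ≤ K * |x - y|)
    {x y : ℝ} (hx : x ∈ Icc l u) (hy : y ∈ Icc l u) :
    |F y - F x - F' x * (y - x) - F₂ x / 2 * (y - x) ^ 2| ≤ K * |y - x| ^ 3 := by
  have hsub : uIcc x y ⊆ Icc l u := uIcc_subset_Icc hx hy
  have h := (convex_uIcc x y).norm_image_sub_le_of_norm_hasDerivWithin_le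
    (f := fun z => F z - F' x * z - F₂ x / 2 * (z - x) ^ 2)
    (f' := fun z => F' z - F' x - F₂ x * (z - x)) (C := K * |y - x| ^ 2)
    (fun z hz => by
      have := ((hF z (hsub hz)).sub ((hasDerivAt_id z).const_mul (F' x))).sub
        ((((hasDerivAt_id z).sub_const x).pow 2).const_mul (F₂ x / 2))
      refine (this.congr_deriv ?_).hasDerivWithinAt
      simp
      ring)
    (fun z hz => by
      have h1 := abs_sub_sub_le_of_lipschitz_deriv h0 hF' hK hx (hsub hz)
      have h2 : |z - x| ≤ |y - x| := abs_sub_left_of_mem_uIcc hz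
      rw [Real.norm_eq_abs]
      exact h1.trans (by gcongr)) left_mem_uIcc right_mem_uIcc
  rw [Real.norm_eq_abs, Real.norm_eq_abs] at h
  rw [show F y - F x - F' x * (y - x) - F₂ x / 2 * (y - x) ^ 2 =
    F y - F' x * y - F₂ x / 2 * (y - x) ^ 2 -
      (F x - F' x * x - F₂ x / 2 * (x - x) ^ 2) by ring]
  calc _ ≤ _ := h
    _ = _ := by ring

lemma exists_lipschitz_of_contDiffAt {H : ℝ × ℝ → ℝ} {s : Set (ℝ × ℝ)} (hs : IsCompact s)
    (hH : ∀ p ∈ s, ContDiffAt ℝ 1 H p) :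
    ∃ K : ℝ, 0 ≤ K ∧ ∀ p ∈ s, ∀ p' ∈ s, |H p - H p'| ≤ K * dist p p' := by
  have hloc : LocallyLipschitzOn s H := fun p hp => by
    obtain ⟨K, t, ht, hK⟩ := (hH p hp).exists_lipschitzOnWith
    exact ⟨K, t, mem_nhdsWithin_of_mem_nhds ht, hK⟩
  obtain ⟨K, hK⟩ := hloc.exists_lipschitzOnWith_of_compact hs
  exact ⟨K, K.2, fun p hp p' hp' => hK.dist_le_mul p hp p' hp'⟩

lemma contDiffAt_bstabDD {ρ : ℝ} {p : ℝ × ℝ} (h1 : p.1 ∈ Ioo (0 : ℝ) 1)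
    (h2 : p.2 ∈ Ioo (0 : ℝ) 1) : ContDiffAt ℝ 1 (fun p : ℝ × ℝ => bstabDD ρ p.1 p.2) p := by
  have hq1 : ContDiffAt ℝ 1 (fun p : ℝ × ℝ => gquant p.1) p :=
    (contDiffAt_gquant h1).comp p contDiffAt_fst
  have hq2 : ContDiffAt ℝ 1 (fun p : ℝ × ℝ => gquant p.2) p :=
    (contDiffAt_gquant h2).comp p contDiffAt_snd
  unfold bstabDD
  refine ContDiffAt.mul (contDiff_gpdf.contDiffAt.comp p (by fun_prop)) ?_
  have := (contDiff_gpdf.contDiffAt.comp p hq1).inv (gpdf_pos _).ne'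
  exact ((contDiffAt_const.mul this).neg).div_const _

lemma contDiffAt_bstabDM {ρ : ℝ} {p : ℝ × ℝ} (h1 : p.1 ∈ Ioo (0 : ℝ) 1)
    (h2 : p.2 ∈ Ioo (0 : ℝ) 1) : ContDiffAt ℝ 1 (fun p : ℝ × ℝ => bstabDM ρ p.1 p.2) p := by
  have hq1 : ContDiffAt ℝ 1 (fun p : ℝ × ℝ => gquant p.1) p :=
    (contDiffAt_gquant h1).comp p contDiffAt_fst
  have hq2 : ContDiffAt ℝ 1 (fun p : ℝ × ℝ => gquant p.2) p :=
    (contDiffAt_gquant h2).comp p contDiffAt_snd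
  unfold bstabDM
  refine ContDiffAt.mul (contDiff_gpdf.contDiffAt.comp p (by fun_prop)) ?_
  exact ((contDiff_gpdf.contDiffAt.comp p hq2).inv (gpdf_pos _).ne').div_const _

/-- A uniform second-order upper Taylor bound for `bstab` away from the boundary of the square. -/
lemma exists_bstab_taylor {ρ η : ℝ} (hρ : ρ ^ 2 < 1) (hη : 0 < η) :
    ∃ K : ℝ, 0 ≤ K ∧ (∀ a ∈ Icc η (1 - η), ∀ b ∈ Icc η (1 - η),
      |bstabDD ρ a b| ≤ K ∧ |bstabDM ρ a b| ≤ K) ∧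
      ∀ a ∈ Icc η (1 - η), ∀ b ∈ Icc η (1 - η), ∀ a' ∈ Icc η (1 - η), ∀ b' ∈ Icc η (1 - η),
        bstab ρ a' b' ≤ bstab ρ a b + bstabD ρ a b * (a' - a) + bstabD ρ b a * (b' - b) +
          (bstabDD ρ a b * (a' - a) ^ 2 + 2 * bstabDM ρ a b * ((a' - a) * (b' - b)) +
            bstabDD ρ b a * (b' - b) ^ 2) / 2 + K * (|a' - a| + |b' - b|) ^ 3 := by
  have hsub : ∀ a ∈ Icc η (1 - η), a ∈ Ioo (0 : ℝ) 1 := fun a ha =>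
    ⟨hη.trans_le ha.1, ha.2.trans_lt (by linarith)⟩
  have hcomp : IsCompact (Icc η (1 - η) ×ˢ Icc η (1 - η)) := isCompact_Icc.prod isCompact_Icc
  have hDD : ∀ p ∈ Icc η (1 - η) ×ˢ Icc η (1 - η),
      ContDiffAt ℝ 1 (fun p : ℝ × ℝ => bstabDD ρ p.1 p.2) p := fun p hp =>
    contDiffAt_bstabDD (hsub _ hp.1) (hsub _ hp.2)
  have hDM : ∀ p ∈ Icc η (1 - η) ×ˢ Icc η (1 - η),
      ContDiffAt ℝ 1 (fun p : ℝ × ℝ => bstabDM ρ p.1 p.2) p := fun p hp =>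
    contDiffAt_bstabDM (hsub _ hp.1) (hsub _ hp.2)
  obtain ⟨K₁, hK₁, hL₁⟩ := exists_lipschitz_of_contDiffAt hcomp hDD
  obtain ⟨K₂, hK₂, hL₂⟩ := exists_lipschitz_of_contDiffAt hcomp hDM
  obtain ⟨M₁, hM₁⟩ := hcomp.exists_bound_of_continuousOn
    (f := fun p : ℝ × ℝ => bstabDD ρ p.1 p.2)
    fun p hp => (hDD p hp).continuousAt.continuousWithinAt
  obtain ⟨M₂, hM₂⟩ := hcomp.exists_bound_of_continuousOn
    (f := fun p : ℝ × ℝ => bstabDM ρ p.1 p.2)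
    fun p hp => (hDM p hp).continuousAt.continuousWithinAt
  set K := max (max K₁ K₂) (max M₁ M₂) with hKdef
  have k1 : K₁ ≤ K := (le_max_left _ _).trans (le_max_left _ _)
  have k2 : K₂ ≤ K := (le_max_right _ _).trans (le_max_left _ _)
  have k3 : M₁ ≤ K := (le_max_left _ _).trans (le_max_right _ _)
  have k4 : M₂ ≤ K := (le_max_right _ _).trans (le_max_right _ _)
  have hK0 : 0 ≤ K := hK₁.trans k1
  have hL1 : ∀ b ∈ Icc η (1 - η), ∀ a ∈ Icc η (1 - η), ∀ a' ∈ Icc η (1 - η),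
      |bstabDD ρ a b - bstabDD ρ a' b| ≤ K * |a - a'| := fun b hb a ha a' ha' => by
    have h := hL₁ (a, b) ⟨ha, hb⟩ (a', b) ⟨ha', hb⟩
    rw [Prod.dist_eq, dist_self, max_eq_left dist_nonneg, Real.dist_eq] at h
    exact h.trans (by gcongr)
  have hL2 : ∀ a ∈ Icc η (1 - η), ∀ b ∈ Icc η (1 - η), ∀ b' ∈ Icc η (1 - η),
      |bstabDD ρ a b - bstabDD ρ a b'| ≤ K * |b - b'| := fun a ha b hb b' hb' => by
    have h := hL₁ (a, b) ⟨ha, hb⟩ (a, b') ⟨ha, hb'⟩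
    rw [Prod.dist_eq, dist_self, max_eq_right dist_nonneg, Real.dist_eq] at h
    exact h.trans (by gcongr)
  have hL3 : ∀ a ∈ Icc η (1 - η), ∀ b ∈ Icc η (1 - η), ∀ b' ∈ Icc η (1 - η),
      |bstabDM ρ a b - bstabDM ρ a b'| ≤ K * |b - b'| := fun a ha b hb b' hb' => by
    have h := hL₂ (a, b) ⟨ha, hb⟩ (a, b') ⟨ha, hb'⟩
    rw [Prod.dist_eq, dist_self, max_eq_right dist_nonneg, Real.dist_eq] at h
    exact h.trans (by gcongr)
  refine ⟨K, hK0, fun a ha b hb => ⟨(hM₁ (a, b) ⟨ha, hb⟩).trans k3,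
    (hM₂ (a, b) ⟨ha, hb⟩).trans k4⟩, fun a ha b hb a' ha' b' hb' => ?_⟩
  have t1 := le_of_abs_le (taylor_two_le (F := fun a => bstab ρ a b')
    (F' := fun a => bstabD ρ a b') (F₂ := fun a => bstabDD ρ a b') hK0
    (fun x hx => hasDerivAt_bstab hρ (hsub x hx) (hsub b' hb'))
    (fun x hx => hasDerivAt_bstabD_left (hsub x hx)) (hL1 b' hb') ha ha')
  have t2 := le_of_abs_le (taylor_two_le (F := fun b => bstab ρ b a)
    (F' := fun b => bstabD ρ b a) (F₂ := fun b => bstabDD ρ b a) hK0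
    (fun x hx => hasDerivAt_bstab hρ (hsub x hx) (hsub a ha))
    (fun x hx => hasDerivAt_bstabD_left (hsub x hx)) (hL1 a ha) hb hb')
  have t3 := abs_sub_sub_le_of_lipschitz_deriv (F := fun b => bstabD ρ a b)
    (F' := fun b => bstabDM ρ a b) hK0
    (fun x hx => hasDerivAt_bstabD_right (hsub x hx)) (hL3 a ha) hb hb'
  have t4 := le_of_abs_le (hL2 a ha b' hb' b hb)
  rw [bstab_comm hρ (hsub b' hb') (hsub a ha), bstab_comm hρ (hsub b hb) (hsub a ha)] at t2
  have t5 : (bstabD ρ a b' - bstabD ρ a b - bstabDM ρ a b * (b' - b)) * (a' - a) ≤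
      K * |b' - b| ^ 2 * |a' - a| := by
    refine (le_abs_self _).trans ?_
    rw [abs_mul]
    gcongr
  have t6 : (bstabDD ρ a b' - bstabDD ρ a b) * (a' - a) ^ 2 ≤ K * |b' - b| * |a' - a| ^ 2 := by
    rw [sq_abs]
    gcongr
  have t7 : 0 ≤ K * |b' - b| * |a' - a| ^ 2 := by positivity
  have t8 : 0 ≤ K * |b' - b| ^ 2 * |a' - a| := by positivity
  have t9 : K * (|a' - a| + |b' - b|) ^ 3 = K * |a' - a| ^ 3 + K * |b' - b| ^ 3 +
      3 * (K * |b' - b| * |a' - a| ^ 2) + 3 * (K * |b' - b| ^ 2 * |a' - a|) := by ring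
  rw [t9]
  linarith

theorem MeasurePreserving.integral_comp_of_measurable {α β : Type*} [MeasurableSpace α]
    [MeasurableSpace β] {μ : Measure α} {ν : Measure β} {T : α → β} (hT : MeasurePreserving T μ ν)
    {F : β → ℝ} (hF : Measurable F) : ∫ x, F (T x) ∂μ = ∫ y, F y ∂ν := by
  rw [← hT.map_eq, integral_map hT.measurable.aemeasurable hF.aestronglyMeasurable]

theorem measurePreserving_correlated {ρ : ℝ} (hρ : ρ ^ 2 ≤ 1) (v : ℝ≥0) :
    MeasurePreserving (fun p : ℝ × ℝ => ρ * p.1 + √(1 - ρ ^ 2) * p.2)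
      ((gaussianReal 0 v).prod (gaussianReal 0 v)) (gaussianReal 0 v) :=
  ⟨by fun_prop, map_correlated hρ v⟩

/-- Gaussian smoothing with variance `v`. -/
noncomputable def heat (v : ℝ≥0) (f : ℝ → ℝ) (x : ℝ) : ℝ := ∫ z, f (x + z) ∂gaussianReal 0 v

/-- `f` takes values in `[η, 1 - η]` and has first-order expansion with coefficient `p` and
quantitative error, all bounds being uniform. -/
structure SmoothFn (η L : ℝ) (f p : ℝ → ℝ) : Prop where
  measurable : Measurable f
  measurable_deriv : Measurable p
  mem_Icc : ∀ x, f x ∈ Icc η (1 - η)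
  deriv_le : ∀ x, |p x| ≤ L
  lipschitz : ∀ x u, |f (x + u) - f x| ≤ L * |u|
  taylor : ∀ x u, |f (x + u) - f x - p x * u| ≤ L * u ^ 2

theorem integrable_of_abs_le {α : Type*} [MeasurableSpace α] {μ : Measure α} [IsFiniteMeasure μ]
    {f : α → ℝ} (hf : Measurable f) {C : ℝ} (h : ∀ x, |f x| ≤ C) : Integrable f μ :=
  Integrable.of_bound hf.aestronglyMeasurable C (ae_of_all _ h)

theorem SmoothFn.abs_le_one {η L : ℝ} {f p : ℝ → ℝ} (hη : 0 < η) (h : SmoothFn η L f p) (x : ℝ) :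
    |f x| ≤ 1 := by
  have := h.mem_Icc x
  rw [abs_le]; constructor <;> linarith [this.1, this.2]

theorem abs_integral_le_of_le {α : Type*} [MeasurableSpace α] {μ : Measure α}
    [IsProbabilityMeasure μ] {f : α → ℝ} {C : ℝ} (h : ∀ x, |f x| ≤ C) : |∫ x, f x ∂μ| ≤ C := by
  have := norm_integral_le_of_norm_le_const (μ := μ) (f := f) (C := C) (ae_of_all _ h)
  simpa using this

theorem measurable_heat {f : ℝ → ℝ} (hf : Measurable f) (v : ℝ≥0) : Measurable (heat v f) :=
  (StronglyMeasurable.integral_prod_right (ν := gaussianReal 0 v) (f := fun x z => f (x + z))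
    (hf.comp (measurable_fst.add measurable_snd)).stronglyMeasurable).measurable

theorem integral_mem_Icc_of_mem {α : Type*} [MeasurableSpace α] {μ : Measure α}
    [IsProbabilityMeasure μ] {f : α → ℝ} {a b : ℝ} (hf : Integrable f μ)
    (h : ∀ x, f x ∈ Icc a b) : ∫ x, f x ∂μ ∈ Icc a b := by
  constructor
  · simpa using integral_mono (integrable_const a) hf (fun x => (h x).1)
  · simpa using integral_mono hf (integrable_const b) (fun x => (h x).2)

theorem SmoothFn.heat {η L : ℝ} {f p : ℝ → ℝ} (hη : 0 < η) (h : SmoothFn η L f p) (v : ℝ≥0) :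
    SmoothFn η L (heat v f) (heat v p) := by
  have If : ∀ x, Integrable (fun z => f (x + z)) (gaussianReal 0 v) := fun x =>
    integrable_of_abs_le (h.measurable.comp (measurable_const_add x)) (fun z => h.abs_le_one hη _)
  have Ip : ∀ x, Integrable (fun z => p (x + z)) (gaussianReal 0 v) := fun x =>
    integrable_of_abs_le (h.measurable_deriv.comp (measurable_const_add x))
      (fun z => h.deriv_le _)
  refine ⟨measurable_heat h.measurable v, measurable_heat h.measurable_deriv v, fun x => ?_,
    fun x => ?_, fun x u => ?_, fun x u => ?_⟩
  · exact integral_mem_Icc_of_mem (If x) (fun z => h.mem_Icc _)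
  · exact abs_integral_le_of_le fun z => h.deriv_le _
  · unfold _root_.heat
    rw [← integral_sub (If _) (If _)]
    refine abs_integral_le_of_le fun z => ?_
    have := h.lipschitz (x + z) u
    rwa [show x + z + u = x + u + z by ring] at this
  · unfold _root_.heat
    have I2 : Integrable (fun z => f (x + u + z) - f (x + z)) (gaussianReal 0 v) :=
      (If _).sub (If _)
    rw [← integral_sub (If _) (If _), ← integral_mul_const,
      ← integral_sub I2 ((Ip _).mul_const _)]
    refine abs_integral_le_of_le fun z => ?_
    have := h.taylor (x + z) u
    rwa [show x + z + u = x + u + z by ring] at this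

theorem integrable_abs_pow_gaussian (v : ℝ≥0) (k : ℕ) :
    Integrable (fun z : ℝ => |z| ^ k) (gaussianReal 0 v) := by
  have := (memLp_id_gaussianReal (μ := 0) (v := v) (k : ℝ≥0)).integrable_norm_pow'
  simpa using this

theorem integrable_pow_gaussian (v : ℝ≥0) (k : ℕ) :
    Integrable (fun z : ℝ => z ^ k) (gaussianReal 0 v) := by
  refine (integrable_abs_pow_gaussian v k).mono' (by fun_prop) (ae_of_all _ fun z => ?_)
  simp

theorem integral_sq_gaussian (v : ℝ≥0) : ∫ z : ℝ, z ^ 2 ∂gaussianReal 0 v = v := by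
  have h := variance_id_gaussianReal (μ := 0) (v := v)
  rw [variance_eq_integral (by fun_prop)] at h
  simpa [integral_id_gaussianReal] using h

theorem integral_abs_cube_gaussian (v : ℝ≥0) :
    ∫ z : ℝ, |z| ^ 3 ∂gaussianReal 0 v = √v ^ 3 * ∫ z : ℝ, |z| ^ 3 ∂γ := by
  have h := gaussianReal_map_const_mul (μ := 0) (v := 1) (√(v : ℝ))
  have e : (NNReal.mk (√(v : ℝ) ^ 2) (sq_nonneg _)) * 1 = v := by
    ext; simp [Real.sq_sqrt]
  rw [e, mul_zero] at h
  conv_lhs => rw [← h]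
  rw [integral_map (by fun_prop) (by fun_prop), ← integral_const_mul]
  refine integral_congr_ae (ae_of_all _ fun z => ?_)
  simp only [abs_mul, mul_pow, abs_of_nonneg (Real.sqrt_nonneg _)]

theorem SmoothFn.abs_heat_sub_le {η L : ℝ} {f p : ℝ → ℝ} (hη : 0 < η) (h : SmoothFn η L f p)
    (v : ℝ≥0) (x : ℝ) : |_root_.heat v f x - f x| ≤ L * v := by
  have If : Integrable (fun z => f (x + z)) (gaussianReal 0 v) :=
    integrable_of_abs_le (h.measurable.comp (measurable_const_add x)) (fun z => h.abs_le_one hη _)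
  have Iz : Integrable (fun z : ℝ => z) (gaussianReal 0 v) := by
    simpa using integrable_pow_gaussian v 1
  have I2 : Integrable (fun z => f (x + z) - f x) (gaussianReal 0 v) :=
    If.sub (integrable_const _)
  have e : _root_.heat v f x - f x = ∫ z, (f (x + z) - f x - p x * z) ∂gaussianReal 0 v := by
    rw [integral_sub I2 (Iz.const_mul _),
      integral_sub If (integrable_const _), integral_const_mul, integral_id_gaussianReal]
    simp [_root_.heat]
  rw [e, ← integral_sq_gaussian v, ← integral_const_mul]
  refine (abs_integral_le_integral_abs).trans ?_
  exact integral_mono ((I2.sub (Iz.const_mul _)).abs)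
    ((integrable_pow_gaussian v 2).const_mul _) (fun z => h.taylor x z)

theorem abs_mul_sub_mul_le {L n δ ε U V : ℝ} (hδ : |δ - U| ≤ L * n ^ 2)
    (hε : |ε - V| ≤ L * n ^ 2) (hε' : |ε| ≤ L * n) (hU : |U| ≤ L * n) :
    |δ * ε - U * V| ≤ 2 * L ^ 2 * n ^ 3 := by
  have e : δ * ε - U * V = (δ - U) * ε + U * (ε - V) := by ring
  rw [e]
  refine (abs_add_le _ _).trans ?_
  rw [abs_mul, abs_mul]
  have h1 := mul_le_mul hδ hε' (abs_nonneg _) ((abs_nonneg _).trans hδ)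
  have h2 := mul_le_mul hU hε (abs_nonneg _) ((abs_nonneg _).trans hU)
  linarith

theorem quadratic_form_le {A B C K L n δ ε U V : ℝ} (hA : |A| ≤ K)
    (hB : |B| ≤ K) (hC : |C| ≤ K) (hδ : |δ - U| ≤ L * n ^ 2) (hε : |ε - V| ≤ L * n ^ 2)
    (hδ' : |δ| ≤ L * n) (hε' : |ε| ≤ L * n) (hU : |U| ≤ L * n) (hV : |V| ≤ L * n) :
    (A * δ ^ 2 + 2 * B * (δ * ε) + C * ε ^ 2) / 2 + K * (|δ| + |ε|) ^ 3 ≤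
      (A * U ^ 2 + 2 * B * (U * V) + C * V ^ 2) / 2 + (4 * K * L ^ 2 + 8 * K * L ^ 3) * n ^ 3 := by
  have hK : 0 ≤ K := (abs_nonneg _).trans hA
  have key : ∀ {c s t : ℝ}, |c| ≤ K → |s - t| ≤ 2 * L ^ 2 * n ^ 3 →
      c * s ≤ c * t + K * (2 * L ^ 2 * n ^ 3) := by
    intro c s t hc hst
    have h1 : c * (s - t) ≤ |c| * |s - t| := by rw [← abs_mul]; exact le_abs_self _
    have h2 := mul_le_mul hc hst (abs_nonneg _) hK
    linarith [mul_sub c s t]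
  have h1 := key hA (abs_mul_sub_mul_le hδ hδ hδ' hU)
  have h2 := key hB (abs_mul_sub_mul_le hδ hε hε' hU)
  have h3 := key hC (abs_mul_sub_mul_le hε hε hε' hV)
  have h4 : (|δ| + |ε|) ^ 3 ≤ (2 * (L * n)) ^ 3 :=
    pow_le_pow_left₀ (by positivity) (by linarith) 3
  have h5 := mul_le_mul_of_nonneg_left h4 hK
  linarith

theorem SmoothFn.increment_bounds {η L : ℝ} {f p : ℝ → ℝ} (hη : 0 < η) (h : SmoothFn η L f p)
    {v : ℝ≥0} (hv : v ≤ 1) (x u n : ℝ) (hn : √v + |u| ≤ n) :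
    |f (x + u) - _root_.heat v f x| ≤ L * n ∧
      |f (x + u) - _root_.heat v f x - p x * u| ≤ L * n ^ 2 ∧ |p x * u| ≤ L * n := by
  have hL : 0 ≤ L := (abs_nonneg _).trans (h.deriv_le x)
  have hs : √(v : ℝ) ^ 2 = v := Real.sq_sqrt v.coe_nonneg
  have hs0 : 0 ≤ √(v : ℝ) := Real.sqrt_nonneg _
  have hs1 : √(v : ℝ) ≤ 1 := Real.sqrt_le_one.mpr (by exact_mod_cast hv)
  have hu := abs_nonneg u
  have h1 := abs_le.1 (h.abs_heat_sub_le hη v x)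
  have h2 := abs_le.1 (h.lipschitz x u)
  have h3 := abs_le.1 (h.taylor x u)
  have hvs : (v : ℝ) ≤ √v := by nlinarith
  have hn0 : 0 ≤ n := by linarith
  have e1 : L * |u| + L * v ≤ L * n := by nlinarith
  have e2 : L * u ^ 2 + L * v ≤ L * n ^ 2 := by
    have : u ^ 2 + v ≤ n ^ 2 := by rw [← sq_abs u, ← hs]; nlinarith
    nlinarith
  refine ⟨abs_le.2 ⟨by linarith, by linarith⟩, abs_le.2 ⟨by linarith, by linarith⟩, ?_⟩
  rw [abs_mul]
  exact mul_le_mul (h.deriv_le x) (by linarith) hu hL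

theorem add_cube_le {a b c : ℝ} (ha : 0 ≤ a) (hb : 0 ≤ b) (hc : 0 ≤ c) :
    (a + b + c) ^ 3 ≤ 9 * (a ^ 3 + b ^ 3 + c ^ 3) := by
  have h1 : (a + b + c) ^ 2 ≤ 3 * (a ^ 2 + b ^ 2 + c ^ 2) := by
    nlinarith [sq_nonneg (a - b), sq_nonneg (b - c), sq_nonneg (a - c)]
  have key : ∀ x y : ℝ, 0 ≤ x → 0 ≤ y → x ^ 2 * y + x * y ^ 2 ≤ x ^ 3 + y ^ 3 := by
    intro x y hx hy; nlinarith [mul_nonneg (add_nonneg hx hy) (sq_nonneg (x - y))]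
  have h2 : (a ^ 2 + b ^ 2 + c ^ 2) * (a + b + c) ≤ 3 * (a ^ 3 + b ^ 3 + c ^ 3) := by
    nlinarith [key a b ha hb, key b c hb hc, key a c ha hc]
  have h3 := mul_le_mul_of_nonneg_right h1 (by positivity : 0 ≤ a + b + c)
  nlinarith

/-- One step of the semigroup argument: averaging over a correlated Gaussian increment of variance
`h` increases the functional by at most `O(h ^ (3 / 2))`. -/
theorem exists_bstab_step {ρ η : ℝ} (h0 : 0 ≤ ρ) (h1 : ρ < 1) (hη : 0 < η) (L : ℝ) :
    ∃ C, 0 ≤ C ∧ ∀ (h : ℝ≥0), h ≤ 1 → ∀ f p g r : ℝ → ℝ, SmoothFn η L f p → SmoothFn η L g r →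
      ∀ x y : ℝ, ∫ q, bstab ρ (f (x + q.1)) (g (y + (ρ * q.1 + √(1 - ρ ^ 2) * q.2)))
          ∂((gaussianReal 0 h).prod (gaussianReal 0 h)) ≤
        bstab ρ (heat h f x) (heat h g y) + C * (h * √h) := by
  have hρ : ρ ^ 2 < 1 := by nlinarith
  obtain ⟨K, hK, hKb, hT⟩ := exists_bstab_taylor hρ hη
  set m : ℝ := ∫ z : ℝ, |z| ^ 3 ∂γ with hm
  have hm0 : 0 ≤ m := integral_nonneg fun z => by positivity
  by_cases hL : 0 ≤ L
  swap
  · exact ⟨0, le_rfl, fun h _ f p g r hf _ x => absurd ((abs_nonneg _).trans (hf.deriv_le x)) hL⟩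
  set C₀ := 4 * K * L ^ 2 + 8 * K * L ^ 3 with hC₀
  have hC₀0 : 0 ≤ C₀ := by positivity
  refine ⟨C₀ * (9 * (1 + 2 * m)), by positivity, fun h hh f p g r hf hg x y => ?_⟩
  set μ := gaussianReal 0 h with hμ
  set W : ℝ × ℝ → ℝ := fun q => ρ * q.1 + √(1 - ρ ^ 2) * q.2 with hW
  have mpW : MeasurePreserving W (μ.prod μ) μ := measurePreserving_correlated hρ.le h
  have mpF : MeasurePreserving Prod.fst (μ.prod μ) μ := measurePreserving_fst
  set a := heat h f x with ha
  set b := heat h g y with hb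
  have hamem := (hf.heat hη h).mem_Icc x
  have hbmem := (hg.heat hη h).mem_Icc y
  obtain ⟨hA, hB⟩ := hKb a hamem b hbmem
  obtain ⟨hC, -⟩ := hKb b hbmem a hamem
  set A := bstabDD ρ a b
  set B := bstabDM ρ a b
  set C := bstabDD ρ b a
  have If : Integrable (fun q : ℝ × ℝ => f (x + q.1)) (μ.prod μ) :=
    integrable_of_abs_le (hf.measurable.comp (by fun_prop)) (fun z => hf.abs_le_one hη _)
  have Ig : Integrable (fun q : ℝ × ℝ => g (y + W q)) (μ.prod μ) :=
    integrable_of_abs_le (hg.measurable.comp (by fun_prop)) (fun z => hg.abs_le_one hη _)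
  have Ef : ∫ q, f (x + q.1) ∂(μ.prod μ) = a :=
    MeasurePreserving.integral_comp_of_measurable mpF (F := fun u => f (x + u))
      (hf.measurable.comp (by fun_prop))
  have Eg : ∫ q, g (y + W q) ∂(μ.prod μ) = b :=
    MeasurePreserving.integral_comp_of_measurable mpW (F := fun u => g (y + u))
      (hg.measurable.comp (by fun_prop))
  have Iu2 : Integrable (fun q : ℝ × ℝ => q.1 ^ 2) (μ.prod μ) :=
    (mpF.integrable_comp (by fun_prop)).2 (integrable_pow_gaussian h 2)
  have Iw2 : Integrable (fun q : ℝ × ℝ => W q ^ 2) (μ.prod μ) :=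
    (mpW.integrable_comp (g := fun z : ℝ => z ^ 2) (by fun_prop)).2 (integrable_pow_gaussian h 2)
  have Iz : Integrable (fun z : ℝ => z) μ := by simpa using integrable_pow_gaussian h 1
  have Iuv : Integrable (fun q : ℝ × ℝ => q.1 * q.2) (μ.prod μ) := Iz.mul_prod Iz
  have euw : (fun q : ℝ × ℝ => q.1 * W q) =
      fun q => ρ * q.1 ^ 2 + √(1 - ρ ^ 2) * (q.1 * q.2) := by
    funext q; simp only [hW]; ring
  have Iuw : Integrable (fun q : ℝ × ℝ => q.1 * W q) (μ.prod μ) := by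
    rw [euw]; exact (Iu2.const_mul _).add (Iuv.const_mul _)
  have Eu2 : ∫ q : ℝ × ℝ, q.1 ^ 2 ∂(μ.prod μ) = h := by
    rw [← integral_sq_gaussian h]
    exact MeasurePreserving.integral_comp_of_measurable mpF (F := fun u => u ^ 2) (by fun_prop)
  have Ew2 : ∫ q : ℝ × ℝ, W q ^ 2 ∂(μ.prod μ) = h := by
    rw [← integral_sq_gaussian h]
    exact MeasurePreserving.integral_comp_of_measurable mpW (F := fun u => u ^ 2) (by fun_prop)
  have Euw : ∫ q : ℝ × ℝ, q.1 * W q ∂(μ.prod μ) = ρ * h := by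
    rw [euw, integral_add (Iu2.const_mul _) (Iuv.const_mul _), integral_const_mul,
      integral_const_mul, Eu2, integral_prod_mul (fun z : ℝ => z) (fun z : ℝ => z)]
    simp [hμ, integral_id_gaussianReal]
  have Iu3 : Integrable (fun q : ℝ × ℝ => |q.1| ^ 3) (μ.prod μ) :=
    (mpF.integrable_comp (g := fun z : ℝ => |z| ^ 3) (by fun_prop)).2
      (integrable_abs_pow_gaussian h 3)
  have Iw3 : Integrable (fun q : ℝ × ℝ => |W q| ^ 3) (μ.prod μ) :=
    (mpW.integrable_comp (g := fun z : ℝ => |z| ^ 3) (by fun_prop)).2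
      (integrable_abs_pow_gaussian h 3)
  have Eu3 : ∫ q : ℝ × ℝ, |q.1| ^ 3 ∂(μ.prod μ) = √h ^ 3 * m := by
    rw [hm, ← integral_abs_cube_gaussian h]
    exact MeasurePreserving.integral_comp_of_measurable mpF (F := fun u => |u| ^ 3) (by fun_prop)
  have Ew3 : ∫ q : ℝ × ℝ, |W q| ^ 3 ∂(μ.prod μ) = √h ^ 3 * m := by
    rw [hm, ← integral_abs_cube_gaussian h]
    exact MeasurePreserving.integral_comp_of_measurable mpW (F := fun u => |u| ^ 3) (by fun_prop)
  have hpt : ∀ q : ℝ × ℝ, bstab ρ (f (x + q.1)) (g (y + W q)) ≤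
      bstab ρ a b + bstabD ρ a b * (f (x + q.1) - a) + bstabD ρ b a * (g (y + W q) - b) +
        (A * p x ^ 2 / 2 * q.1 ^ 2 + B * (p x * r y) * (q.1 * W q) + C * r y ^ 2 / 2 * W q ^ 2) +
        C₀ * 9 * (√h ^ 3 + |q.1| ^ 3 + |W q| ^ 3) := by
    intro q
    have hsn := Real.sqrt_nonneg (h : ℝ)
    obtain ⟨d1, d2, d3⟩ := hf.increment_bounds hη hh x q.1 (√h + |q.1| + |W q|)
      (by linarith [abs_nonneg (W q)])
    obtain ⟨e1, e2, e3⟩ := hg.increment_bounds hη hh y (W q) (√h + |q.1| + |W q|)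
      (by linarith [abs_nonneg q.1])
    have t := hT a hamem b hbmem _ (hf.mem_Icc (x + q.1)) _ (hg.mem_Icc (y + W q))
    have k := quadratic_form_le hA hB hC d2 e2 d1 e1 d3 e3
    have n3 := mul_le_mul_of_nonneg_left
      (add_cube_le hsn (abs_nonneg q.1) (abs_nonneg (W q))) hC₀0
    linarith
  have I1 : Integrable (fun q : ℝ × ℝ => bstabD ρ a b * (f (x + q.1) - a)) (μ.prod μ) :=
    (If.sub (integrable_const _)).const_mul _
  have I2 : Integrable (fun q : ℝ × ℝ => bstabD ρ b a * (g (y + W q) - b)) (μ.prod μ) :=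
    (Ig.sub (integrable_const _)).const_mul _
  have I3 : Integrable (fun q : ℝ × ℝ => bstab ρ a b + bstabD ρ a b * (f (x + q.1) - a))
    (μ.prod μ) := (integrable_const _).add I1
  have I4 : Integrable (fun q : ℝ × ℝ => bstab ρ a b + bstabD ρ a b * (f (x + q.1) - a) +
    bstabD ρ b a * (g (y + W q) - b)) (μ.prod μ) := I3.add I2
  have I5 : Integrable (fun q : ℝ × ℝ => A * p x ^ 2 / 2 * q.1 ^ 2 +
    B * (p x * r y) * (q.1 * W q)) (μ.prod μ) := (Iu2.const_mul _).add (Iuw.const_mul _)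
  have I6 : Integrable (fun q : ℝ × ℝ => A * p x ^ 2 / 2 * q.1 ^ 2 +
    B * (p x * r y) * (q.1 * W q) + C * r y ^ 2 / 2 * W q ^ 2) (μ.prod μ) :=
    I5.add (Iw2.const_mul _)
  have I7 : Integrable (fun q : ℝ × ℝ => √h ^ 3 + |q.1| ^ 3) (μ.prod μ) :=
    (integrable_const _).add Iu3
  have I8 : Integrable (fun q : ℝ × ℝ => C₀ * 9 * (√h ^ 3 + |q.1| ^ 3 + |W q| ^ 3)) (μ.prod μ) :=
    (I7.add Iw3).const_mul _
  have I9 := I4.add I6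
  have Ib : Integrable (fun q : ℝ × ℝ => bstab ρ (f (x + q.1)) (g (y + W q))) (μ.prod μ) := by
    refine integrable_of_mem_Icc ?_ fun q => ⟨bstab_nonneg _ _ _, bstab_le_one _ _ _⟩
    exact (continuous_bstab hρ.le).measurable.comp
      ((hf.measurable.comp (by fun_prop)).prodMk (hg.measurable.comp (by fun_prop)))
  have hint := integral_mono Ib (I9.add I8) hpt
  refine hint.trans ?_
  simp only [Pi.add_apply]
  rw [integral_add (by exact I9) I8, integral_add I4 I6, integral_add I3 I2,
    integral_add (integrable_const _) I1, integral_add I5 (Iw2.const_mul _),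
    integral_add (Iu2.const_mul _) (Iuw.const_mul _)]
  simp only [integral_const_mul]
  rw [integral_add I7 Iw3, integral_add (integrable_const _) Iu3,
    integral_sub If (integrable_const _), integral_sub Ig (integrable_const _), Ef, Eg, Eu2, Euw,
    Ew2, Eu3, Ew3]
  have hform := bstab_form_nonpos h0 h1 a b (p x) (r y)
  have hs : (h : ℝ) * √h = √h ^ 3 := by rw [pow_succ, Real.sq_sqrt h.coe_nonneg]
  have hform' := mul_nonpos_of_nonneg_of_nonpos h.coe_nonneg hform
  have h2 : (h : ℝ) * (A * p x ^ 2 + 2 * ρ * B * p x * r y + C * r y ^ 2) ≤ 0 := hform'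
  rw [hs]
  simp only [integral_const, probReal_univ, one_smul, sub_self, mul_zero, add_zero]
  linarith

theorem measurePreserving_prodProdProdComm {α β δ ε : Type*} [MeasurableSpace α]
    [MeasurableSpace β] [MeasurableSpace δ] [MeasurableSpace ε] (μ : Measure α) (ν : Measure β)
    (κ : Measure δ) (τ : Measure ε) [SFinite μ] [SFinite ν] [SFinite κ] [SFinite τ] :
    MeasurePreserving (fun q : (α × β) × (δ × ε) => ((q.1.1, q.2.1), (q.1.2, q.2.2)))
      ((μ.prod ν).prod (κ.prod τ)) ((μ.prod κ).prod (ν.prod τ)) := by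
  have e1 := measurePreserving_prodAssoc μ ν (κ.prod τ)
  have e2 := (measurePreserving_prodAssoc ν κ τ).symm
  have e3 := (Measure.measurePreserving_swap (μ := ν) (ν := κ)).prod (MeasurePreserving.id τ)
  have e4 := measurePreserving_prodAssoc κ ν τ
  have e5 := (MeasurePreserving.id μ).prod ((e4.comp e3).comp e2)
  have e6 := (measurePreserving_prodAssoc μ κ (ν.prod τ)).symm
  exact (e6.comp e5).comp e1

theorem measurePreserving_add_gaussian (v w : ℝ≥0) :
    MeasurePreserving (fun q : ℝ × ℝ => q.1 + q.2) ((gaussianReal 0 v).prod (gaussianReal 0 w))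
      (gaussianReal 0 (v + w)) := by
  refine ⟨by fun_prop, ?_⟩
  have := gaussianReal_conv_gaussianReal (m₁ := 0) (m₂ := 0) (v₁ := v) (v₂ := w)
  rw [add_zero] at this
  exact this

theorem measurePreserving_add_gaussian_prod (v w : ℝ≥0) :
    MeasurePreserving (fun q : (ℝ × ℝ) × (ℝ × ℝ) => q.1 + q.2)
      (((gaussianReal 0 v).prod (gaussianReal 0 v)).prod
        ((gaussianReal 0 w).prod (gaussianReal 0 w)))
      ((gaussianReal 0 (v + w)).prod (gaussianReal 0 (v + w))) :=
  ((measurePreserving_add_gaussian v w).prod (measurePreserving_add_gaussian v w)).comp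
    (measurePreserving_prodProdProdComm _ _ _ _)

theorem heat_heat {η L : ℝ} {f p : ℝ → ℝ} (hη : 0 < η) (hf : SmoothFn η L f p) (v w : ℝ≥0)
    (x : ℝ) : heat v (heat w f) x = heat (v + w) f x := by
  unfold heat
  rw [← MeasurePreserving.integral_comp_of_measurable (measurePreserving_add_gaussian v w)
    (F := fun z => f (x + z)) (hf.measurable.comp (by fun_prop)), integral_prod]
  · simp only [add_assoc]
  · exact integrable_of_abs_le (hf.measurable.comp (by fun_prop)) (fun z => hf.abs_le_one hη _)

theorem heat_zero {f : ℝ → ℝ} (x : ℝ) : heat 0 f x = f x := by simp [heat, gaussianReal_zero_var]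

theorem measurable_bstab_comp {α : Type*} [MeasurableSpace α] {ρ : ℝ} (hρ : ρ ^ 2 ≤ 1)
    {f g : α → ℝ} (hf : Measurable f) (hg : Measurable g) :
    Measurable fun x => bstab ρ (f x) (g x) :=
  (continuous_bstab hρ).measurable.comp (hf.prodMk hg)

theorem integrable_bstab_comp {α : Type*} [MeasurableSpace α] {μ : Measure α} [IsFiniteMeasure μ]
    {ρ : ℝ} (hρ : ρ ^ 2 ≤ 1) {f g : α → ℝ} (hf : Measurable f) (hg : Measurable g) :
    Integrable (fun x => bstab ρ (f x) (g x)) μ :=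
  integrable_of_mem_Icc (measurable_bstab_comp hρ hf hg)
    fun _ => ⟨bstab_nonneg _ _ _, bstab_le_one _ _ _⟩

theorem exists_bstab_steps {ρ η : ℝ} (h0 : 0 ≤ ρ) (h1 : ρ < 1) (hη : 0 < η) (L : ℝ) :
    ∃ C, 0 ≤ C ∧ ∀ (h : ℝ≥0), h ≤ 1 → ∀ (k : ℕ) (f p g r : ℝ → ℝ), SmoothFn η L f p →
      SmoothFn η L g r → ∀ x y : ℝ,
        ∫ q, bstab ρ (f (x + q.1)) (g (y + (ρ * q.1 + √(1 - ρ ^ 2) * q.2)))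
          ∂((gaussianReal 0 (k * h)).prod (gaussianReal 0 (k * h))) ≤
        bstab ρ (heat (k * h) f x) (heat (k * h) g y) + k * (C * (h * √h)) := by
  have hρ : ρ ^ 2 ≤ 1 := by nlinarith
  obtain ⟨C, hC, hstep⟩ := exists_bstab_step h0 h1 hη L
  refine ⟨C, hC, fun h hh k => ?_⟩
  induction k with
  | zero =>
    intro f p g r hf hg x y
    simp [gaussianReal_zero_var, heat_zero, Measure.dirac_prod_dirac]
  | succ k ih =>
    intro f p g r hf hg x y
    have e : ((k + 1 : ℕ) : ℝ≥0) * h = k * h + h := by push_cast; ring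
    have II : Integrable (fun q : (ℝ × ℝ) × (ℝ × ℝ) => bstab ρ (f (x + (q.1 + q.2).1))
        (g (y + (ρ * (q.1 + q.2).1 + √(1 - ρ ^ 2) * (q.1 + q.2).2))))
        (((gaussianReal 0 (k * h)).prod (gaussianReal 0 (k * h))).prod
          ((gaussianReal 0 h).prod (gaussianReal 0 h))) :=
      integrable_bstab_comp hρ (hf.measurable.comp (by fun_prop))
        (hg.measurable.comp (by fun_prop))
    rw [e, ← MeasurePreserving.integral_comp_of_measurable
      (measurePreserving_add_gaussian_prod (k * h) h)
      (F := fun q => bstab ρ (f (x + q.1)) (g (y + (ρ * q.1 + √(1 - ρ ^ 2) * q.2))))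
      (measurable_bstab_comp hρ (hf.measurable.comp (by fun_prop))
        (hg.measurable.comp (by fun_prop))),
      integral_prod _ II,
      ← heat_heat hη hf, ← heat_heat hη hg]
    have ih' := ih (heat h f) (heat h p) (heat h g) (heat h r) (hf.heat hη h) (hg.heat hη h) x y
    have hinner : ∀ q : ℝ × ℝ, ∫ q', bstab ρ (f (x + (q + q').1))
        (g (y + (ρ * (q + q').1 + √(1 - ρ ^ 2) * (q + q').2)))
          ∂((gaussianReal 0 h).prod (gaussianReal 0 h)) ≤
        bstab ρ (heat h f (x + q.1)) (heat h g (y + (ρ * q.1 + √(1 - ρ ^ 2) * q.2))) +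
          C * (h * √h) := by
      intro q
      refine le_trans (le_of_eq ?_) (hstep h hh f p g r hf hg (x + q.1)
        (y + (ρ * q.1 + √(1 - ρ ^ 2) * q.2)))
      refine integral_congr_ae (ae_of_all _ fun q' => ?_)
      simp only [Prod.fst_add, Prod.snd_add]
      congr 2 <;> ring
    have Ib := integrable_bstab_comp
      (μ := (gaussianReal 0 (k * h)).prod (gaussianReal 0 (k * h))) hρ
      (((hf.heat hη h).measurable.comp (by fun_prop : Measurable fun q : ℝ × ℝ => x + q.1)))
      (((hg.heat hη h).measurable.comp
        (by fun_prop : Measurable fun q : ℝ × ℝ => y + (ρ * q.1 + √(1 - ρ ^ 2) * q.2))))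
    refine (integral_mono II.integral_prod_left
      (Ib.add (integrable_const (C * (h * √h)))) hinner).trans ?_
    simp only [Pi.add_apply]
    rw [integral_add Ib (integrable_const _)]
    simp only [integral_const, probReal_univ, one_smul, Function.comp_apply]
    push_cast
    linarith

theorem SmoothFn.integral_bstab_le {ρ η L : ℝ} (h0 : 0 ≤ ρ) (h1 : ρ < 1) (hη : 0 < η)
    {f p g r : ℝ → ℝ} (hf : SmoothFn η L f p) (hg : SmoothFn η L g r) :
    ∫ q, bstab ρ (f q.1) (g (ρ * q.1 + √(1 - ρ ^ 2) * q.2)) ∂((γ).prod γ) ≤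
      bstab ρ (∫ x, f x ∂γ) (∫ x, g x ∂γ) := by
  obtain ⟨C, hC, hs⟩ := exists_bstab_steps h0 h1 hη L
  have key : ∀ n : ℕ, ∫ q, bstab ρ (f q.1) (g (ρ * q.1 + √(1 - ρ ^ 2) * q.2)) ∂((γ).prod γ) ≤
      bstab ρ (∫ x, f x ∂γ) (∫ x, g x ∂γ) + C * √(1 / ((n : ℝ) + 1)) := by
    intro n
    have hn : ((n : ℝ≥0) + 1) ≠ 0 := by positivity
    have h := hs (1 / ((n : ℝ≥0) + 1)) (by
      rw [div_le_one (by positivity)]; simp) (n + 1) f p g r hf hg 0 0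
    have e : ((n + 1 : ℕ) : ℝ≥0) * (1 / ((n : ℝ≥0) + 1)) = 1 := by
      push_cast; field_simp
    rw [e] at h
    simp only [zero_add, _root_.heat] at h
    refine h.trans (le_of_eq ?_)
    push_cast
    have : (n : ℝ) + 1 ≠ 0 := by positivity
    congr 1
    field_simp
  have lim : Tendsto (fun n : ℕ => bstab ρ (∫ x, f x ∂γ) (∫ x, g x ∂γ) +
      C * √(1 / ((n : ℝ) + 1))) atTop
      (𝓝 (bstab ρ (∫ x, f x ∂γ) (∫ x, g x ∂γ) + C * √0)) :=
    ((tendsto_one_div_add_atTop_nhds_zero_nat.sqrt).const_mul C).const_add _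
  rw [Real.sqrt_zero, mul_zero, add_zero] at lim
  exact ge_of_tendsto' lim key

theorem SmoothFn.mono {η η' L L' : ℝ} {f p : ℝ → ℝ} (h : SmoothFn η L f p) (hη : η' ≤ η)
    (hL : L ≤ L') : SmoothFn η' L' f p where
  measurable := h.measurable
  measurable_deriv := h.measurable_deriv
  mem_Icc x := ⟨hη.trans (h.mem_Icc x).1, (h.mem_Icc x).2.trans (by linarith)⟩
  deriv_le x := (h.deriv_le x).trans hL
  lipschitz x u := (h.lipschitz x u).trans (mul_le_mul_of_nonneg_right hL (abs_nonneg _))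
  taylor x u := (h.taylor x u).trans (mul_le_mul_of_nonneg_right hL (sq_nonneg _))

theorem exists_smoothFn_of_contDiff {φ : ℝ → ℝ} (hφ : ContDiff ℝ 2 φ) (hc : HasCompactSupport φ)
    {η s t : ℝ} (hs0 : 0 ≤ s) (hs1 : s ≤ 1) (h : ∀ x, s * φ x + t ∈ Icc η (1 - η)) :
    ∃ L, SmoothFn η L (fun x => s * φ x + t) (fun x => s * deriv φ x) := by
  have hφ1 : ContDiff ℝ 1 (deriv φ) := by
    have h2 : ContDiff ℝ (1 + 1) φ := by rwa [one_add_one_eq_two]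
    exact (contDiff_succ_iff_deriv.1 h2).2.2
  have hd : ∀ x, HasDerivAt φ (deriv φ x) x := fun x =>
    (hφ.differentiable (by norm_num) x).hasDerivAt
  have hdd : ∀ x, HasDerivAt (deriv φ) (deriv (deriv φ) x) x := fun x =>
    (hφ1.differentiable (by norm_num) x).hasDerivAt
  obtain ⟨A, hA⟩ := hc.deriv.exists_bound_of_continuous hφ1.continuous
  obtain ⟨B, hB⟩ := hc.deriv.deriv.exists_bound_of_continuous
    (hφ1.continuous_deriv (by norm_num))
  have hA0 : 0 ≤ A := (norm_nonneg _).trans (hA 0)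
  have hB0 : 0 ≤ B := (norm_nonneg _).trans (hB 0)
  have lip : ∀ x y, |φ y - φ x| ≤ A * |y - x| := fun x y =>
    convex_univ.norm_image_sub_le_of_norm_hasDerivWithin_le (f := φ) (f' := deriv φ)
      (fun z _ => (hd z).hasDerivWithinAt) (fun z _ => hA z) (mem_univ x) (mem_univ y)
  have lip' : ∀ x y, |deriv φ y - deriv φ x| ≤ B * |y - x| := fun x y =>
    convex_univ.norm_image_sub_le_of_norm_hasDerivWithin_le (f := deriv φ)
      (f' := deriv (deriv φ)) (fun z _ => (hdd z).hasDerivWithinAt) (fun z _ => hB z)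
      (mem_univ x) (mem_univ y)
  have shrink : ∀ {a b : ℝ}, |a| ≤ b → |s * a| ≤ b := by
    intro a b hab
    rw [abs_mul, abs_of_nonneg hs0]
    exact (mul_le_of_le_one_left (abs_nonneg a) hs1).trans hab
  refine ⟨A + B, ⟨?_, ?_, h, fun x => ?_, fun x u => ?_, fun x u => ?_⟩⟩
  · have := hφ.continuous.measurable
    fun_prop
  · have := hφ1.continuous.measurable
    fun_prop
  · exact shrink ((hA x).trans (by linarith))
  · have := lip x (x + u)
    rw [add_sub_cancel_left] at this
    rw [show s * φ (x + u) + t - (s * φ x + t) = s * (φ (x + u) - φ x) by ring]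
    refine shrink (this.trans (mul_le_mul_of_nonneg_right (by linarith) (abs_nonneg u)))
  · have hmem : x ∈ Icc (x - |u|) (x + |u|) := by
      constructor <;> linarith [abs_nonneg u]
    have hmem' : x + u ∈ Icc (x - |u|) (x + |u|) := by
      constructor <;> linarith [neg_abs_le u, le_abs_self u]
    have := abs_sub_sub_le_of_lipschitz_deriv hB0 (fun z _ => hd z)
      (fun z _ w _ => lip' w z) hmem hmem'
    rw [add_sub_cancel_left, sq_abs] at this
    rw [show s * φ (x + u) + t - (s * φ x + t) - s * deriv φ x * u =
      s * (φ (x + u) - φ x - deriv φ x * u) by ring]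
    refine shrink (this.trans (mul_le_mul_of_nonneg_right (by linarith) (sq_nonneg u)))

theorem exists_smoothFn_approx {f : ℝ → ℝ} (hf : Measurable f) (h : ∀ x, f x ∈ Icc (0 : ℝ) 1)
    {ε : ℝ} (hε : 0 < ε) :
    ∃ η L f' p, 0 < η ∧ SmoothFn η L f' p ∧ ∫ x, |f' x - f x| ∂γ ≤ 12 * ε := by
  obtain ⟨φ₀, hc₀, hi₀, hcont₀, hint₀⟩ :=
    (integrable_of_mem_Icc (μ := γ) hf h).exists_hasCompactSupport_integral_sub_le hε
  set φ₁ : ℝ → ℝ := fun x => max 0 (min (φ₀ x) 1) with hφ₁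
  have hcont₁ : Continuous φ₁ := by fun_prop
  have hc₁ : HasCompactSupport φ₁ :=
    hc₀.comp_left (g := fun z : ℝ => max 0 (min z 1)) (by simp)
  obtain ⟨φ, hφ, hclose, hsupp⟩ := hcont₁.exists_contDiff_approx ⊤ (ε := fun _ => ε)
    (by fun_prop) (fun _ => hε)
  have hc : HasCompactSupport φ := hc₁.mono hsupp
  have h01 : ∀ x, |f x - φ₁ x| ≤ |f x - φ₀ x| := by
    intro x
    obtain ⟨h1, h2⟩ := h x
    simp only [hφ₁]
    rcases le_total (φ₀ x) 1 with h3 | h3 <;> rcases le_total 0 (φ₀ x) with h4 | h4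
    · rw [min_eq_left h3, max_eq_right h4]
    · rw [min_eq_left h3, max_eq_left h4, abs_of_nonneg (by linarith),
        abs_of_nonneg (by linarith)]
      linarith
    · rw [min_eq_right h3, max_eq_right zero_le_one, abs_sub_comm, abs_sub_comm (f x),
        abs_of_nonneg (by linarith), abs_of_nonneg (by linarith)]
      linarith
    · linarith
  have hφ₁mem : ∀ x, φ₁ x ∈ Icc (0 : ℝ) 1 := fun x =>
    ⟨le_max_left _ _, max_le zero_le_one (min_le_right _ _)⟩
  have hcl : ∀ x, |φ x - φ₁ x| < ε := hclose
  have h4 : 0 < 1 + 4 * ε := by linarith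
  have hmem : ∀ x, 1 / (1 + 4 * ε) * φ x + 2 * ε / (1 + 4 * ε) ∈
      Icc (ε / (1 + 4 * ε)) (1 - ε / (1 + 4 * ε)) := by
    intro x
    have h1 := abs_lt.1 (hcl x)
    have h2 := hφ₁mem x
    have e1 : 1 / (1 + 4 * ε) * φ x + 2 * ε / (1 + 4 * ε) = (φ x + 2 * ε) / (1 + 4 * ε) := by
      ring
    have e2 : 1 - ε / (1 + 4 * ε) = (1 + 3 * ε) / (1 + 4 * ε) := by field_simp; ring
    rw [e1, e2]
    constructor
    · exact div_le_div_of_nonneg_right (by linarith [h2.1]) h4.le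
    · exact div_le_div_of_nonneg_right (by linarith [h2.2]) h4.le
  obtain ⟨L, hL⟩ := exists_smoothFn_of_contDiff (contDiff_infty.1 hφ 2) hc
    (by positivity) ((div_le_one h4).2 (by linarith)) hmem
  refine ⟨_, L, _, _, by positivity, hL, ?_⟩
  have hpt : ∀ x, |1 / (1 + 4 * ε) * φ x + 2 * ε / (1 + 4 * ε) - f x| ≤
      |f x - φ₀ x| + 11 * ε := by
    intro x
    have h1 := abs_lt.1 (hcl x)
    have h2 := hφ₁mem x
    have h3 := h01 x
    have e : 1 / (1 + 4 * ε) * φ x + 2 * ε / (1 + 4 * ε) - φ x =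
        (2 * ε - 4 * ε * φ x) / (1 + 4 * ε) := by field_simp; ring
    have h5 : |1 / (1 + 4 * ε) * φ x + 2 * ε / (1 + 4 * ε) - φ x| ≤ 10 * ε := by
      rw [e, abs_div, abs_of_pos h4, div_le_iff₀ h4, abs_le]
      constructor <;> nlinarith [h2.1, h2.2]
    have h6 := abs_le.1 h5
    have h7 := abs_le.1 h3
    rw [abs_le]
    constructor <;> linarith
  have I0 : Integrable (fun x => |f x - φ₀ x|) γ :=
    ((integrable_of_mem_Icc hf h).sub hint₀).abs
  have I1 : Integrable (fun x => |1 / (1 + 4 * ε) * φ x + 2 * ε / (1 + 4 * ε) - f x|) γ :=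
    ((integrable_of_abs_le hL.measurable (hL.abs_le_one (by positivity))).sub
      (integrable_of_mem_Icc hf h)).abs
  refine (integral_mono I1 (I0.add (integrable_const _)) hpt).trans ?_
  simp only [Pi.add_apply]
  rw [integral_add I0 (integrable_const _)]
  have : ∫ x, |f x - φ₀ x| ∂γ ≤ ε := hi₀
  simp only [integral_const, probReal_univ, one_smul]
  linarith

/-- Borell's inequality in functional form on the line. -/
theorem integral_bstab_le_real {ρ : ℝ} (h0 : 0 ≤ ρ) (h1 : ρ < 1) {f g : ℝ → ℝ}
    (hf : Measurable f) (hf' : ∀ x, f x ∈ Icc (0 : ℝ) 1) (hg : Measurable g)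
    (hg' : ∀ x, g x ∈ Icc (0 : ℝ) 1) :
    ∫ q, bstab ρ (f q.1) (g (ρ * q.1 + √(1 - ρ ^ 2) * q.2)) ∂((γ).prod γ) ≤
      bstab ρ (∫ x, f x ∂γ) (∫ x, g x ∂γ) := by
  have hρ : ρ ^ 2 ≤ 1 := by nlinarith
  refine le_of_forall_pos_le_add fun ε' hε' => ?_
  obtain ⟨ε, hε, hεε'⟩ : ∃ ε : ℝ, 0 < ε ∧ 48 * ε ≤ ε' := ⟨ε' / 48, by positivity, by linarith⟩
  obtain ⟨η₁, L₁, F, p, hη₁, hF, hFf⟩ := exists_smoothFn_approx hf hf' hε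
  obtain ⟨η₂, L₂, G, r, hη₂, hG, hGg⟩ := exists_smoothFn_approx hg hg' hε
  have hη : 0 < min η₁ η₂ := lt_min hη₁ hη₂
  have main := SmoothFn.integral_bstab_le h0 h1 hη
    (hF.mono (min_le_left η₁ η₂) (le_max_left L₁ L₂))
    (hG.mono (min_le_right η₁ η₂) (le_max_right L₁ L₂))
  have IF : Integrable F γ := integrable_of_abs_le hF.measurable (hF.abs_le_one hη₁)
  have IG : Integrable G γ := integrable_of_abs_le hG.measurable (hG.abs_le_one hη₂)
  have If : Integrable f γ := integrable_of_mem_Icc hf hf'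
  have Ig : Integrable g γ := integrable_of_mem_Icc hg hg'
  have mF : Measurable fun x => |F x - f x| := (hF.measurable.sub hf).abs
  have mG : Measurable fun x => |G x - g x| := (hG.measurable.sub hg).abs
  have dF : |∫ x, F x ∂γ - ∫ x, f x ∂γ| ≤ 12 * ε := by
    rw [← integral_sub IF If]
    exact abs_integral_le_integral_abs.trans hFf
  have dG : |∫ x, G x ∂γ - ∫ x, g x ∂γ| ≤ 12 * ε := by
    rw [← integral_sub IG Ig]
    exact abs_integral_le_integral_abs.trans hGg
  have right := bstab_le hρ (∫ x, f x ∂γ) (∫ x, g x ∂γ) (∫ x, F x ∂γ) (∫ x, G x ∂γ)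
  have mpW := measurePreserving_correlated hρ 1
  have mpF : MeasurePreserving (Prod.fst : ℝ × ℝ → ℝ) ((γ).prod γ) γ := measurePreserving_fst
  have E1 : ∫ q : ℝ × ℝ, |F q.1 - f q.1| ∂((γ).prod γ) ≤ 12 * ε :=
    (MeasurePreserving.integral_comp_of_measurable mpF mF).trans_le hFf
  have E2 : ∫ q : ℝ × ℝ, |G (ρ * q.1 + √(1 - ρ ^ 2) * q.2) - g (ρ * q.1 + √(1 - ρ ^ 2) * q.2)|
      ∂((γ).prod γ) ≤ 12 * ε :=
    (MeasurePreserving.integral_comp_of_measurable mpW mG).trans_le hGg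
  have I1 : Integrable (fun q : ℝ × ℝ => |F q.1 - f q.1|) ((γ).prod γ) :=
    (mpF.integrable_comp mF.aestronglyMeasurable).2 (IF.sub If).abs
  have I2 : Integrable (fun q : ℝ × ℝ => |G (ρ * q.1 + √(1 - ρ ^ 2) * q.2) -
      g (ρ * q.1 + √(1 - ρ ^ 2) * q.2)|) ((γ).prod γ) :=
    (mpW.integrable_comp mG.aestronglyMeasurable).2 (IG.sub Ig).abs
  have J1 : Integrable (fun q : ℝ × ℝ => bstab ρ (f q.1) (g (ρ * q.1 + √(1 - ρ ^ 2) * q.2)))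
      ((γ).prod γ) :=
    integrable_bstab_comp hρ (hf.comp (by fun_prop)) (hg.comp (by fun_prop))
  have J2 : Integrable (fun q : ℝ × ℝ => bstab ρ (F q.1) (G (ρ * q.1 + √(1 - ρ ^ 2) * q.2)))
      ((γ).prod γ) :=
    integrable_bstab_comp hρ (hF.measurable.comp (by fun_prop)) (hG.measurable.comp (by fun_prop))
  have left := integral_mono J1 (J2.add (I1.add I2)) (fun q => by
    have := bstab_le hρ (F q.1) (G (ρ * q.1 + √(1 - ρ ^ 2) * q.2)) (f q.1)
      (g (ρ * q.1 + √(1 - ρ ^ 2) * q.2))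
    rw [abs_sub_comm (f q.1), abs_sub_comm (g _)] at this
    exact this)
  rw [integral_add' J2 (I1.add I2), integral_add' I1 I2] at left
  linarith

/-- The functional form of Borell's inequality for a measure `μ` and a coupling map `T`. -/
def IsBorell {α : Type*} [MeasurableSpace α] (ρ : ℝ) (μ : Measure α) (T : α × α → α) : Prop :=
  ∀ f g : α → ℝ, Measurable f → Measurable g → (∀ x, f x ∈ Icc (0 : ℝ) 1) →
    (∀ x, g x ∈ Icc (0 : ℝ) 1) →
    ∫ q, bstab ρ (f q.1) (g (T q)) ∂(μ.prod μ) ≤ bstab ρ (∫ x, f x ∂μ) (∫ x, g x ∂μ)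

theorem IsBorell.of_subsingleton {α : Type*} [MeasurableSpace α] [Subsingleton α] (ρ : ℝ)
    (μ : Measure α) [IsProbabilityMeasure μ] (T : α × α → α) : IsBorell ρ μ T := by
  intro f g _ _ _ _
  obtain ⟨x₀⟩ := nonempty_of_isProbabilityMeasure μ
  have ef : f = fun _ => f x₀ := funext fun x => by rw [Subsingleton.elim x x₀]
  have eg : g = fun _ => g x₀ := funext fun x => by rw [Subsingleton.elim x x₀]
  rw [ef, eg]
  simp

theorem IsBorell.prod {α β : Type*} [MeasurableSpace α] [MeasurableSpace β] {ρ : ℝ}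
    (hρ : ρ ^ 2 ≤ 1) {μ : Measure α} {ν : Measure β} [IsProbabilityMeasure μ]
    [IsProbabilityMeasure ν] {T : α × α → α} {S : β × β → β} (hT : Measurable T)
    (hS : Measurable S) (hμ : IsBorell ρ μ T) (hν : IsBorell ρ ν S) :
    IsBorell ρ (μ.prod ν) fun q => (T (q.1.1, q.2.1), S (q.1.2, q.2.2)) := by
  intro f g hf hg hf' hg'
  have mF : Measurable fun x => ∫ y, f (x, y) ∂ν :=
    (StronglyMeasurable.integral_prod_right (f := fun x y => f (x, y))
      hf.stronglyMeasurable).measurable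
  have mG : Measurable fun x => ∫ y, g (x, y) ∂ν :=
    (StronglyMeasurable.integral_prod_right (f := fun x y => g (x, y))
      hg.stronglyMeasurable).measurable
  have key := hμ _ _ mF mG
    (fun x => integral_mem_Icc (hf.comp measurable_prodMk_left) fun y => hf' _)
    (fun x => integral_mem_Icc (hg.comp measurable_prodMk_left) fun y => hg' _)
  rw [← integral_prod f (integrable_of_mem_Icc hf hf'),
    ← integral_prod g (integrable_of_mem_Icc hg hg')] at key
  refine le_trans ?_ key
  have II : Integrable (fun q : (α × α) × (β × β) =>
      bstab ρ (f (q.1.1, q.2.1)) (g (T q.1, S q.2))) ((μ.prod μ).prod (ν.prod ν)) :=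
    integrable_bstab_comp hρ (hf.comp (by fun_prop)) (hg.comp (by fun_prop))
  rw [MeasurePreserving.integral_comp_of_measurable (measurePreserving_prodProdProdComm μ ν μ ν)
    (F := fun q : (α × α) × (β × β) => bstab ρ (f (q.1.1, q.2.1)) (g (T q.1, S q.2)))
    (measurable_bstab_comp hρ (hf.comp (by fun_prop)) (hg.comp (by fun_prop))),
    integral_prod _ II]
  refine integral_mono II.integral_prod_left (integrable_bstab_comp hρ (mF.comp measurable_fst)
    (mG.comp hT)) fun q => ?_
  exact hν (fun y => f (q.1, y)) (fun y => g (T q, y)) (hf.comp measurable_prodMk_left)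
    (hg.comp measurable_prodMk_left) (fun y => hf' _) (fun y => hg' _)

theorem IsBorell.of_measurePreserving {α β : Type*} [MeasurableSpace α] [MeasurableSpace β] {ρ : ℝ}
    (hρ : ρ ^ 2 ≤ 1) {μ : Measure α} {ν : Measure β} [IsProbabilityMeasure μ]
    {T : α × α → α} {S : β × β → β} (hS : Measurable S) (e : α ≃ᵐ β) (he : MeasurePreserving e μ ν)
    (hTS : ∀ x y, S (e x, e y) = e (T (x, y))) (hν : IsBorell ρ ν S) : IsBorell ρ μ T := by
  intro f g hf hg hf' hg'
  have mf : Measurable fun y => f (e.symm y) := hf.comp e.symm.measurable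
  have mg : Measurable fun y => g (e.symm y) := hg.comp e.symm.measurable
  have key := hν _ _ mf mg (fun y => hf' _) (fun y => hg' _)
  rw [← MeasurePreserving.integral_comp_of_measurable he mf,
    ← MeasurePreserving.integral_comp_of_measurable he mg,
    ← MeasurePreserving.integral_comp_of_measurable (he.prod he)
      (F := fun q => bstab ρ (f (e.symm q.1)) (g (e.symm (S q))))
      (measurable_bstab_comp hρ (mf.comp measurable_fst) (mg.comp hS))] at key
  simpa only [Prod.map_apply, Function.comp_apply, Prod.map, hTS,
    MeasurableEquiv.symm_apply_apply, Prod.mk.eta] using key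

theorem isBorell_real {ρ : ℝ} (h0 : 0 ≤ ρ) (h1 : ρ < 1) :
    IsBorell ρ γ fun q => ρ * q.1 + √(1 - ρ ^ 2) * q.2 :=
  fun _ _ hf hg hf' hg' => integral_bstab_le_real h0 h1 hf hf' hg hg'

theorem isBorell_pi {ρ : ℝ} (h0 : 0 ≤ ρ) (h1 : ρ < 1) (d : ℕ) :
    IsBorell ρ (Measure.pi fun _ : Fin d => γ) fun q => ρ • q.1 + √(1 - ρ ^ 2) • q.2 := by
  have hρ : ρ ^ 2 ≤ 1 := by nlinarith
  induction d with
  | zero => exact IsBorell.of_subsingleton _ _ _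
  | succ n ih =>
    refine IsBorell.of_measurePreserving hρ (by fun_prop)
      (MeasurableEquiv.piFinSuccAbove (fun _ => ℝ) 0)
      (measurePreserving_piFinSuccAbove (fun _ => γ) 0) (fun x y => ?_)
      (IsBorell.prod hρ (by fun_prop) (by fun_prop) (isBorell_real h0 h1) ih)
    rfl

theorem measurePreserving_gauss_pi (d : ℕ) :
    MeasurePreserving (MeasurableEquiv.toLp 2 (Fin d → ℝ)).symm (gauss d)
      (Measure.pi fun _ : Fin d => γ) := by
  refine MeasurePreserving.symm (MeasurableEquiv.toLp 2 (Fin d → ℝ)) ⟨by fun_prop, ?_⟩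
  rw [gauss_eq_stdGaussian]
  exact map_pi_eq_stdGaussian

theorem isBorell_gauss {ρ : ℝ} (h0 : 0 ≤ ρ) (h1 : ρ < 1) (d : ℕ) :
    IsBorell ρ (gauss d) fun q => ρ • q.1 + √(1 - ρ ^ 2) • q.2 :=
  IsBorell.of_measurePreserving (by nlinarith) (by fun_prop) _ (measurePreserving_gauss_pi d)
    (fun x y => rfl) (isBorell_pi h0 h1 d)

theorem indicator_one_mem_Icc {α : Type*} (s : Set α) (x : α) :
    s.indicator (fun _ => (1 : ℝ)) x ∈ Icc (0 : ℝ) 1 := by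
  by_cases h : x ∈ s <;> simp [h]

theorem measurable_indicator_one {α : Type*} [MeasurableSpace α] {s : Set α}
    (hs : MeasurableSet s) : Measurable (s.indicator fun _ => (1 : ℝ)) :=
  measurable_const.indicator hs

theorem mul_mem_Icc {a b : ℝ} (ha : a ∈ Icc (0 : ℝ) 1) (hb : b ∈ Icc (0 : ℝ) 1) :
    a * b ∈ Icc (0 : ℝ) 1 :=
  ⟨mul_nonneg ha.1 hb.1, mul_le_one₀ ha.2 hb.1 hb.2⟩

theorem integral_mul_integral_comp {α : Type*} [MeasurableSpace α] {μ : Measure α}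
    [IsProbabilityMeasure μ] {T : α × α → α} (hT : Measurable T) {f g : α → ℝ} (hf : Measurable f)
    (hg : Measurable g) (hf' : ∀ x, f x ∈ Icc (0 : ℝ) 1) (hg' : ∀ x, g x ∈ Icc (0 : ℝ) 1) :
    ∫ x, f x * ∫ y, g (T (x, y)) ∂μ ∂μ = ∫ q, f q.1 * g (T q) ∂(μ.prod μ) := by
  rw [integral_prod]
  · simp only [integral_const_mul]
  · exact integrable_of_mem_Icc ((hf.comp measurable_fst).mul (hg.comp hT))
      fun q => mul_mem_Icc (hf' _) (hg' _)

theorem integral_mul_OU {d : ℕ} {ρ : ℝ} {f g : EuclideanSpace ℝ (Fin d) → ℝ} (hf : Measurable f)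
    (hg : Measurable g) (hf' : ∀ x, f x ∈ Icc (0 : ℝ) 1) (hg' : ∀ x, g x ∈ Icc (0 : ℝ) 1) :
    ∫ x, f x * OU d ρ g x ∂(gauss d) =
      ∫ q, f q.1 * g (ρ • q.1 + √(1 - ρ ^ 2) • q.2) ∂((gauss d).prod (gauss d)) :=
  integral_mul_integral_comp (T := fun q => ρ • q.1 + √(1 - ρ ^ 2) • q.2) (by fun_prop)
    hf hg hf' hg'

theorem integral_mul_OU1 {ρ : ℝ} {f g : ℝ → ℝ} (hf : Measurable f)
    (hg : Measurable g) (hf' : ∀ x, f x ∈ Icc (0 : ℝ) 1) (hg' : ∀ x, g x ∈ Icc (0 : ℝ) 1) :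
    ∫ x, f x * OU1 ρ g x ∂gauss1R =
      ∫ q, f q.1 * g (ρ * q.1 + √(1 - ρ ^ 2) * q.2) ∂((γ).prod γ) := by
  unfold OU1
  rw [gauss1R_eq]
  exact integral_mul_integral_comp (T := fun q => ρ * q.1 + √(1 - ρ ^ 2) * q.2) (by fun_prop)
    hf hg hf' hg'

theorem integral_indicator_correlated (ρ : ℝ) {s t : Set ℝ} (hs : MeasurableSet s)
    (ht : MeasurableSet t) :
    ∫ q : ℝ × ℝ, s.indicator (fun _ => (1 : ℝ)) q.1 *
        t.indicator (fun _ => (1 : ℝ)) (ρ * q.1 + √(1 - ρ ^ 2) * q.2) ∂((γ).prod γ) =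
      ((γ).prod γ).real {q | q.1 ∈ s ∧ ρ * q.1 + √(1 - ρ ^ 2) * q.2 ∈ t} := by
  have hm : MeasurableSet {q : ℝ × ℝ | q.1 ∈ s ∧ ρ * q.1 + √(1 - ρ ^ 2) * q.2 ∈ t} :=
    (measurable_fst hs).inter ((by fun_prop : Measurable fun q : ℝ × ℝ =>
      ρ * q.1 + √(1 - ρ ^ 2) * q.2) ht)
  rw [← integral_indicator_one hm]
  refine integral_congr_ae (ae_of_all _ fun q => ?_)
  by_cases h1 : q.1 ∈ s <;> by_cases h2 : ρ * q.1 + √(1 - ρ ^ 2) * q.2 ∈ t <;>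
    simp [indicator, h1, h2]

theorem measurableSet_upperInt (t : EReal) : MeasurableSet (upperInt t) := by
  rw [upperInt_eq]
  exact measurable_gcdf measurableSet_Ioi

theorem borellUpper_eq (ρ : ℝ) (ta tb : EReal) :
    borellUpper ρ ta tb = bstab ρ (Phi ta) (Phi tb) := by
  rw [borellUpper, integral_mul_OU1 (measurable_indicator_one (measurableSet_lowerInt ta))
    (measurable_indicator_one (measurableSet_lowerInt tb)) (indicator_one_mem_Icc _)
    (indicator_one_mem_Icc _), integral_indicator_correlated ρ (measurableSet_lowerInt ta)
    (measurableSet_lowerInt tb), lowerInt_eq, lowerInt_eq]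
  rfl

theorem borellLower_le {ρ : ℝ} (hρ : ρ ^ 2 ≤ 1) (ta tb : EReal) :
    borellLower ρ ta tb ≤ Phi tb - bstab ρ (1 - Phi ta) (Phi tb) := by
  rw [borellLower, integral_mul_OU1 (measurable_indicator_one (measurableSet_upperInt ta))
    (measurable_indicator_one (measurableSet_lowerInt tb)) (indicator_one_mem_Icc _)
    (indicator_one_mem_Icc _), integral_indicator_correlated ρ (measurableSet_upperInt ta)
    (measurableSet_lowerInt tb), Phi_eq tb, ← measureReal_correlated hρ (measurableSet_lowerInt tb),
    le_sub_iff_add_le, bstab, ← measureReal_union]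
  · refine measureReal_mono ?_
    rintro q (⟨-, hq⟩ | ⟨-, hq⟩)
    · exact hq
    · rw [measureReal_correlated hρ (measurableSet_lowerInt tb), ← Phi_eq] at hq
      rw [mem_ofPred_eq, lowerInt_eq]
      exact hq
  · rw [Set.disjoint_left]
    rintro q ⟨h1, -⟩ ⟨h2, -⟩
    rw [upperInt_eq] at h1
    exact lt_asymm h1 h2
  · exact measurableSet_bstab _ _ _

theorem mul_le_bstab {ρ a b : ℝ} (h0 : 0 ≤ ρ) (h1 : ρ < 1) (ha : a ∈ Icc (0 : ℝ) 1)
    (hb : b ∈ Icc (0 : ℝ) 1) : a * b ≤ bstab ρ a b := by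
  have hρ : ρ ^ 2 ≤ 1 := by nlinarith
  have hB : (γ).real {x | gcdf x < b} = b := by
    rw [measureReal_gcdf_lt, min_eq_left hb.2, max_eq_right hb.1]
  have hA : (γ).real {x | gcdf x < a} = a := by
    rw [measureReal_gcdf_lt, min_eq_left ha.2, max_eq_right ha.1]
  rcases eq_or_lt_of_le ha.1 with rfl | ha0
  · rw [zero_mul]; exact bstab_nonneg _ _ _
  rcases eq_or_lt_of_le ha.2 with rfl | ha1
  · rw [one_mul, bstab]
    simp only [gcdf_lt_one, true_and]
    exact ((measureReal_correlated hρ (measurableSet_gcdf_lt b)).trans hB).ge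
  obtain ⟨s, hs⟩ := exists_gcdf_eq ⟨ha0, ha1⟩
  set A := {x | gcdf x < a}
  set B := {x | gcdf x < b} with hBdef
  have mA : MeasurableSet A := measurableSet_gcdf_lt a
  have mB : MeasurableSet B := measurableSet_gcdf_lt b
  have iB := measurable_indicator_one mB
  have iA := measurable_indicator_one mA
  set m : ℝ → ℝ := fun x => ∫ y, B.indicator (fun _ => (1 : ℝ)) (ρ * x + √(1 - ρ ^ 2) * y) ∂γ
    with hm
  have mm : Measurable m :=
    (StronglyMeasurable.integral_prod_right (ν := γ)
      (f := fun x y => B.indicator (fun _ => (1 : ℝ)) (ρ * x + √(1 - ρ ^ 2) * y))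
      (iB.comp (by fun_prop : Measurable fun q : ℝ × ℝ =>
        ρ * q.1 + √(1 - ρ ^ 2) * q.2)).stronglyMeasurable).measurable
  have m01 : ∀ x, m x ∈ Icc (0 : ℝ) 1 := fun x =>
    integral_mem_Icc (iB.comp (by fun_prop)) fun y => indicator_one_mem_Icc _ _
  have anti : Antitone m := by
    intro x x' hxx
    refine integral_mono
      (integrable_of_mem_Icc (iB.comp (by fun_prop)) fun y => indicator_one_mem_Icc _ _)
      (integrable_of_mem_Icc (iB.comp (by fun_prop)) fun y => indicator_one_mem_Icc _ _)
      fun y => ?_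
    have hle : ρ * x + √(1 - ρ ^ 2) * y ≤ ρ * x' + √(1 - ρ ^ 2) * y := by
      gcongr
    by_cases h : ρ * x' + √(1 - ρ ^ 2) * y ∈ B
    · have h' : ρ * x + √(1 - ρ ^ 2) * y ∈ B :=
        (strictMono_gcdf.monotone hle).trans_lt h
      simp only [indicator_of_mem h, indicator_of_mem h', le_refl]
    · simp only [indicator_of_notMem h]
      exact (indicator_one_mem_Icc _ _).1
  have Jeq : bstab ρ a b = ∫ x, A.indicator (fun _ => (1 : ℝ)) x * m x ∂γ := by
    rw [hm, integral_mul_integral_comp (T := fun q => ρ * q.1 + √(1 - ρ ^ 2) * q.2) (by fun_prop)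
      iA iB (indicator_one_mem_Icc _) (indicator_one_mem_Icc _),
      integral_indicator_correlated ρ mA mB]
    rfl
  have mint : ∫ x, m x ∂γ = b := by
    have := integral_mul_integral_comp (μ := γ) (T := fun q => ρ * q.1 + √(1 - ρ ^ 2) * q.2)
      (by fun_prop) (measurable_const (a := (1 : ℝ))) iB (fun _ => by simp)
      (indicator_one_mem_Icc _)
    simp only [one_mul] at this
    rw [hm, this, MeasurePreserving.integral_comp_of_measurable
      (measurePreserving_correlated hρ 1) iB, ← hB]
    exact integral_indicator_one mB
  have Aint : ∫ x, A.indicator (fun _ => (1 : ℝ)) x ∂γ = a :=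
    (integral_indicator_one mA).trans hA
  have IA : Integrable (A.indicator fun _ => (1 : ℝ)) γ :=
    integrable_of_mem_Icc iA (indicator_one_mem_Icc _)
  have Im : Integrable m γ := integrable_of_mem_Icc mm m01
  have IAm : Integrable (fun x => A.indicator (fun _ => (1 : ℝ)) x * m x) γ :=
    integrable_of_mem_Icc (iA.mul mm) fun x => mul_mem_Icc (indicator_one_mem_Icc _ _) (m01 x)
  have pt : ∀ x, A.indicator (fun _ => (1 : ℝ)) x * m s + a * m x ≤
      A.indicator (fun _ => (1 : ℝ)) x * m x + a * m s := by
    intro x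
    by_cases hx : x < s
    · have hxA : x ∈ A := by
        change gcdf x < a
        rw [← hs]; exact strictMono_gcdf hx
      rw [indicator_of_mem hxA]
      nlinarith [anti hx.le]
    · have hxA : x ∉ A := by
        change ¬ gcdf x < a
        rw [← hs, strictMono_gcdf.lt_iff_lt]; exact hx
      rw [indicator_of_notMem hxA]
      nlinarith [anti (not_lt.1 hx)]
  have := integral_mono ((IA.mul_const (m s)).add (Im.const_mul a))
    (IAm.add (integrable_const (a * m s))) pt
  rw [integral_add' (IA.mul_const _) (Im.const_mul _), integral_add' IAm (integrable_const _),
    integral_mul_const, integral_const_mul, Aint, mint, ← Jeq] at this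
  simp only [integral_const, probReal_univ, one_smul] at this
  linarith

/-- Borell's inequality for the Ornstein–Uhlenbeck coupling of `[0, 1]`-valued functions. -/
theorem integral_mul_correlated_le {d : ℕ} {ρ : ℝ} (h0 : 0 ≤ ρ) (h1 : ρ < 1)
    {f g : EuclideanSpace ℝ (Fin d) → ℝ} (hf : Measurable f) (hg : Measurable g)
    (hf' : ∀ x, f x ∈ Icc (0 : ℝ) 1) (hg' : ∀ x, g x ∈ Icc (0 : ℝ) 1) :
    ∫ q, f q.1 * g (ρ • q.1 + √(1 - ρ ^ 2) • q.2) ∂((gauss d).prod (gauss d)) ≤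
      bstab ρ (∫ x, f x ∂(gauss d)) (∫ x, g x ∂(gauss d)) := by
  have hρ : ρ ^ 2 ≤ 1 := by nlinarith
  refine le_trans (integral_mono ?_ ?_ fun q => ?_) (isBorell_gauss h0 h1 d f g hf hg hf' hg')
  · exact integrable_of_mem_Icc ((hf.comp measurable_fst).mul (hg.comp (by fun_prop)))
      fun q => mul_mem_Icc (hf' _) (hg' _)
  · exact integrable_bstab_comp hρ (hf.comp measurable_fst) (hg.comp (by fun_prop))
  · exact mul_le_bstab h0 h1 (hf' _) (hg' _)

theorem measurePreserving_gauss_correlated {ρ : ℝ} (hρ : ρ ^ 2 ≤ 1) (d : ℕ) :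
    MeasurePreserving (fun q : EuclideanSpace ℝ (Fin d) × EuclideanSpace ℝ (Fin d) =>
      ρ • q.1 + √(1 - ρ ^ 2) • q.2) ((gauss d).prod (gauss d)) (gauss d) := by
  have hsplit := MeasurePreserving.symm _ (measurePreserving_arrowProdEquivProdArrow ℝ ℝ (Fin d)
    (fun _ => γ) (fun _ => γ))
  have hpi := measurePreserving_pi (fun _ : Fin d => (γ).prod γ) (fun _ : Fin d => γ)
    (fun _ => measurePreserving_correlated hρ 1)
  exact ((MeasurePreserving.symm _ (measurePreserving_gauss_pi d)).comp (hpi.comp hsplit)).comp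
    ((measurePreserving_gauss_pi d).prod (measurePreserving_gauss_pi d))

theorem measurePreserving_gauss_coord {d : ℕ} (i : Fin d) :
    MeasurePreserving (fun x : EuclideanSpace ℝ (Fin d) => x i) (gauss d) γ :=
  (measurePreserving_eval (fun _ : Fin d => γ) i).comp (measurePreserving_gauss_pi d)

theorem measurePreserving_gauss_neg (d : ℕ) :
    MeasurePreserving (fun x : EuclideanSpace ℝ (Fin d) => -x) (gauss d) (gauss d) := by
  refine ⟨measurable_neg, ?_⟩
  rw [gauss_eq_stdGaussian]
  exact stdGaussian_map (LinearIsometryEquiv.neg ℝ)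

theorem measureReal_upperInt (t : EReal) : (γ).real (upperInt t) = Phi t := by
  have h : MeasurePreserving (fun x : ℝ => -x) γ γ :=
    ⟨measurable_neg, by simpa using gaussianReal_map_neg (μ := 0) (v := 1)⟩
  have hs : upperInt t = (fun x : ℝ => -x) ⁻¹' lowerInt t := by
    ext x
    change -t < (x : EReal) ↔ ((-x : ℝ) : EReal) < t
    rw [EReal.coe_neg, EReal.neg_lt_comm]
  rw [hs, h.measureReal_preimage (measurableSet_lowerInt t).nullMeasurableSet, Phi_eq]

theorem integral_coord_mul_OU {d : ℕ} {ρ : ℝ} (i : Fin d) {f g : ℝ → ℝ} (hf : Measurable f)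
    (hg : Measurable g) (hf' : ∀ x, f x ∈ Icc (0 : ℝ) 1) (hg' : ∀ x, g x ∈ Icc (0 : ℝ) 1) :
    ∫ x, f (x i) * OU d ρ (fun y => g (y i)) x ∂(gauss d) = ∫ x, f x * OU1 ρ g x ∂gauss1R := by
  have hi := measurePreserving_gauss_coord i
  rw [integral_mul_OU (f := fun x => f (x i)) (g := fun x => g (x i))
    (hf.comp hi.measurable) (hg.comp hi.measurable) (fun _ => hf' _) (fun _ => hg' _),
    integral_mul_OU1 hf hg hf' hg']
  exact MeasurePreserving.integral_comp_of_measurable (hi.prod hi)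
    (F := fun q : ℝ × ℝ => f q.1 * g (ρ * q.1 + √(1 - ρ ^ 2) * q.2))
    ((hf.comp measurable_fst).mul (hg.comp (by fun_prop)))

theorem SimplexMap.measurable_apply {d m : ℕ} {f : EuclideanSpace ℝ (Fin d) → Fin m → ℝ}
    (hf : SimplexMap d m f) (i : Fin m) : Measurable fun x => f x i :=
  (measurable_pi_apply i).comp hf.1

theorem SimplexMap.mem_Icc {d m : ℕ} {f : EuclideanSpace ℝ (Fin d) → Fin m → ℝ}
    (hf : SimplexMap d m f) (i : Fin m) (x : EuclideanSpace ℝ (Fin d)) : f x i ∈ Icc (0 : ℝ) 1 :=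
  mem_Icc_of_mem_stdSimplex (hf.2 x) i

theorem SimplexMap.apply_one {d : ℕ} {f : EuclideanSpace ℝ (Fin d) → Fin 2 → ℝ}
    (hf : SimplexMap d 2 f) (x : EuclideanSpace ℝ (Fin d)) : f x 1 = 1 - f x 0 := by
  have := (hf.2 x).2
  rw [Fin.sum_univ_two] at this
  linarith

/-- The simplex-valued map with first coordinate `f`. -/
def simplexPair {d : ℕ} (f : EuclideanSpace ℝ (Fin d) → ℝ) (x : EuclideanSpace ℝ (Fin d)) :
    Fin 2 → ℝ :=
  ![f x, 1 - f x]

theorem simplexMap_simplexPair {d : ℕ} {f : EuclideanSpace ℝ (Fin d) → ℝ} (hf : Measurable f)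
    (hf' : ∀ x, f x ∈ Icc (0 : ℝ) 1) : SimplexMap d 2 (simplexPair f) := by
  refine ⟨measurable_pi_iff.2 fun i => ?_, fun x => ⟨fun i => ?_, ?_⟩⟩
  · fin_cases i
    · exact hf
    · exact hf.const_sub 1
  · fin_cases i
    · exact (hf' x).1
    · exact sub_nonneg.2 (hf' x).2
  · simp [simplexPair]

/-- The joint law of a pair of two-valued maps is determined by its marginals and one entry. -/
theorem Cmat_two_eq {d : ℕ} {ρ : ℝ} (hρ : ρ ^ 2 ≤ 1)
    {f g : EuclideanSpace ℝ (Fin d) → Fin 2 → ℝ} (hf : SimplexMap d 2 f) (hg : SimplexMap d 2 g)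
    {a b c : ℝ} (ha : ∫ x, f x 0 ∂(gauss d) = a) (hb : ∫ x, g x 0 ∂(gauss d) = b)
    (hc : ∫ x, f x 0 * OU d ρ (fun y => g y 0) x ∂(gauss d) = c) :
    Cmat d 2 ρ f g = Matrix.of !![c, a - c; b - c, 1 - a - b + c] := by
  have hW := measurePreserving_gauss_correlated hρ d
  have E : ∀ i j, Cmat d 2 ρ f g i j =
      ∫ q, f q.1 i * g (ρ • q.1 + √(1 - ρ ^ 2) • q.2) j ∂((gauss d).prod (gauss d)) := fun i j =>
    integral_mul_OU (hf.measurable_apply i) (hg.measurable_apply j) (hf.mem_Icc i) (hg.mem_Icc j)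
  have F : ∫ q, f q.1 0 ∂((gauss d).prod (gauss d)) = a := by
    rw [← ha]
    exact MeasurePreserving.integral_comp_of_measurable measurePreserving_fst
      (hf.measurable_apply 0)
  have G : ∫ q : EuclideanSpace ℝ (Fin d) × EuclideanSpace ℝ (Fin d),
      g (ρ • q.1 + √(1 - ρ ^ 2) • q.2) 0 ∂((gauss d).prod (gauss d)) = b := by
    rw [← hb]
    exact MeasurePreserving.integral_comp_of_measurable hW (hg.measurable_apply 0)
  have mF : Measurable fun q : EuclideanSpace ℝ (Fin d) × EuclideanSpace ℝ (Fin d) => f q.1 0 :=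
    (hf.measurable_apply 0).comp measurable_fst
  have mG : Measurable fun q : EuclideanSpace ℝ (Fin d) × EuclideanSpace ℝ (Fin d) =>
      g (ρ • q.1 + √(1 - ρ ^ 2) • q.2) 0 := (hg.measurable_apply 0).comp hW.measurable
  have iF := integrable_of_mem_Icc (μ := (gauss d).prod (gauss d)) mF fun q => hf.mem_Icc 0 _
  have iG := integrable_of_mem_Icc (μ := (gauss d).prod (gauss d)) mG fun q => hg.mem_Icc 0 _
  have iFG : Integrable (fun q : EuclideanSpace ℝ (Fin d) × EuclideanSpace ℝ (Fin d) =>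
      f q.1 0 * g (ρ • q.1 + √(1 - ρ ^ 2) • q.2) 0) ((gauss d).prod (gauss d)) :=
    integrable_of_mem_Icc (mF.mul mG) fun q => mul_mem_Icc (hf.mem_Icc 0 _) (hg.mem_Icc 0 _)
  have e00 : Cmat d 2 ρ f g 0 0 = c := hc
  have e00' := (E 0 0).symm.trans e00
  have e01 : Cmat d 2 ρ f g 0 1 = a - c := by
    rw [E, ← F, ← e00', ← integral_sub iF iFG]
    exact integral_congr_ae (.of_forall fun q => by simp only [hg.apply_one]; ring)
  have e10 : Cmat d 2 ρ f g 1 0 = b - c := by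
    rw [E, ← G, ← e00', ← integral_sub iG iFG]
    exact integral_congr_ae (.of_forall fun q => by simp only [hf.apply_one]; ring)
  have e11 : Cmat d 2 ρ f g 1 1 = 1 - a - b + c := by
    have i1F : Integrable (fun q : EuclideanSpace ℝ (Fin d) × EuclideanSpace ℝ (Fin d) =>
        1 - f q.1 0) ((gauss d).prod (gauss d)) := (integrable_const 1).sub iF
    have i1FG : Integrable (fun q : EuclideanSpace ℝ (Fin d) × EuclideanSpace ℝ (Fin d) =>
        1 - f q.1 0 - g (ρ • q.1 + √(1 - ρ ^ 2) • q.2) 0) ((gauss d).prod (gauss d)) := i1F.sub iG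
    have h1 : ∫ q, (1 - f q.1 0) ∂((gauss d).prod (gauss d)) = 1 - a := by
      rw [integral_sub (integrable_const 1) iF, F]
      simp
    rw [E, ← h1, ← G, ← e00', ← integral_sub i1F iG, ← integral_add i1FG iFG]
    exact integral_congr_ae (.of_forall fun q => by
      simp only [hf.apply_one, hg.apply_one]; ring)
  ext i j
  fin_cases i <;> fin_cases j
  · exact e00
  · exact e01
  · exact e10
  · exact e11

theorem Sset_two_eq {d : ℕ} (hd : 1 ≤ d) {ρ : ℝ} (h0 : 0 < ρ) (h1 : ρ < 1) :
    Sset ρ 2 d = { M : Matrix (Fin 2) (Fin 2) ℝ |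
      ∃ (a b c : ℝ) (ta tb : EReal), a ∈ Icc (0 : ℝ) 1 ∧ b ∈ Icc (0 : ℝ) 1 ∧
        Phi ta = a ∧ Phi tb = b ∧
        borellLower ρ ta tb ≤ c ∧ c ≤ borellUpper ρ ta tb ∧
        M = Matrix.of !![c, a - c; b - c, 1 - a - b + c] } := by
  have hρ : ρ ^ 2 ≤ 1 := by nlinarith
  ext M
  constructor
  · rintro ⟨f, g, hf, hg, rfl⟩
    have mf := hf.measurable_apply 0
    have mg := hg.measurable_apply 0
    have ha := integral_mem_Icc (μ := gauss d) mf (hf.mem_Icc 0)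
    have hb := integral_mem_Icc (μ := gauss d) mg (hg.mem_Icc 0)
    obtain ⟨ta, hta⟩ := exists_Phi_eq ha
    obtain ⟨tb, htb⟩ := exists_Phi_eq hb
    refine ⟨_, _, _, ta, tb, ha, hb, hta, htb, ?_, ?_, Cmat_two_eq hρ hf hg rfl rfl rfl⟩
    · refine (borellLower_le hρ ta tb).trans ?_
      have key := integral_mul_correlated_le h0.le h1 (hf.measurable_apply 1) mg (hf.mem_Icc 1)
        (hg.mem_Icc 0)
      have e10 := congrFun (congrFun (Cmat_two_eq hρ hf hg rfl rfl rfl) 1) 0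
      have E := integral_mul_OU (ρ := ρ) (hf.measurable_apply 1) mg (hf.mem_Icc 1) (hg.mem_Icc 0)
      have hf1 : ∫ x, f x 1 ∂(gauss d) = 1 - ∫ x, f x 0 ∂(gauss d) := by
        simp only [hf.apply_one]
        rw [integral_sub (integrable_const 1) (integrable_of_mem_Icc mf (hf.mem_Icc 0))]
        simp
      rw [← E, hf1] at key
      rw [hta, htb]
      change (∫ x, f x 1 * OU d ρ (fun y => g y 0) x ∂(gauss d)) = _ - _ at e10
      linarith
    · rw [borellUpper_eq, hta, htb, integral_mul_OU mf mg (hf.mem_Icc 0) (hg.mem_Icc 0)]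
      exact integral_mul_correlated_le h0.le h1 mf mg (hf.mem_Icc 0) (hg.mem_Icc 0)
  · rintro ⟨a, b, c, ta, tb, -, -, hta, htb, hL, hU, rfl⟩
    obtain ⟨s, t, hs, ht, hst, hc⟩ :=
      (segment_eq_Icc (hL.trans hU)).symm.subset (mem_Icc.2 ⟨hL, hU⟩)
    set u : ℝ → ℝ := (upperInt ta).indicator fun _ => 1
    set v : ℝ → ℝ := (lowerInt ta).indicator fun _ => 1
    set w : ℝ → ℝ := (lowerInt tb).indicator fun _ => 1
    have mu : Measurable u := measurable_indicator_one (measurableSet_upperInt ta)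
    have mv : Measurable v := measurable_indicator_one (measurableSet_lowerInt ta)
    have mw : Measurable w := measurable_indicator_one (measurableSet_lowerInt tb)
    have u01 : ∀ x, u x ∈ Icc (0 : ℝ) 1 := indicator_one_mem_Icc _
    have v01 : ∀ x, v x ∈ Icc (0 : ℝ) 1 := indicator_one_mem_Icc _
    have w01 : ∀ x, w x ∈ Icc (0 : ℝ) 1 := indicator_one_mem_Icc _
    have hu' : ∫ x, u x ∂γ = a := by
      rw [← hta, ← measureReal_upperInt]
      exact integral_indicator_one (measurableSet_upperInt ta)
    have hv' : ∫ x, v x ∂γ = a := by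
      rw [← hta, Phi_eq]
      exact integral_indicator_one (measurableSet_lowerInt ta)
    have hw' : ∫ x, w x ∂γ = b := by
      rw [← htb, Phi_eq]
      exact integral_indicator_one (measurableSet_lowerInt tb)
    have mm : Measurable fun x => s * u x + t * v x := (mu.const_mul s).add (mv.const_mul t)
    have m01 : ∀ x, s * u x + t * v x ∈ Icc (0 : ℝ) 1 := fun x =>
      convex_Icc 0 1 (u01 x) (v01 x) hs ht hst
    let i : Fin d := ⟨0, hd⟩
    have hi := measurePreserving_gauss_coord i
    have hf := simplexMap_simplexPair (f := fun x => s * u (x i) + t * v (x i))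
      (mm.comp hi.measurable) fun x => m01 _
    have hg := simplexMap_simplexPair (f := fun x => w (x i)) (mw.comp hi.measurable) fun x => w01 _
    refine ⟨_, _, hf, hg, (Cmat_two_eq hρ hf hg ?_ ?_ ?_).symm⟩
    · refine (MeasurePreserving.integral_comp_of_measurable hi mm).trans ?_
      rw [integral_add ((integrable_of_mem_Icc mu u01).const_mul s)
        ((integrable_of_mem_Icc mv v01).const_mul t), integral_const_mul, integral_const_mul, hu',
        hv', ← add_mul, hst, one_mul]
    · exact (MeasurePreserving.integral_comp_of_measurable hi mw).trans hw'
    · refine (integral_coord_mul_OU i mm mw m01 w01).trans ?_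
      rw [integral_mul_OU1 mm mw m01 w01]
      have hT : Measurable fun q : ℝ × ℝ => w (ρ * q.1 + √(1 - ρ ^ 2) * q.2) :=
        mw.comp (by fun_prop)
      have iu : Integrable (fun q : ℝ × ℝ => u q.1 * w (ρ * q.1 + √(1 - ρ ^ 2) * q.2))
          ((γ).prod γ) :=
        integrable_of_mem_Icc ((mu.comp measurable_fst).mul hT)
          fun q => mul_mem_Icc (u01 _) (w01 _)
      have iv : Integrable (fun q : ℝ × ℝ => v q.1 * w (ρ * q.1 + √(1 - ρ ^ 2) * q.2))
          ((γ).prod γ) :=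
        integrable_of_mem_Icc ((mv.comp measurable_fst).mul hT)
          fun q => mul_mem_Icc (v01 _) (w01 _)
      rw [← hc, borellLower, borellUpper, integral_mul_OU1 mu mw u01 w01,
        integral_mul_OU1 mv mw v01 w01, smul_eq_mul, smul_eq_mul, ← integral_const_mul,
        ← integral_const_mul, ← integral_add (iu.const_mul s) (iv.const_mul t)]
      exact integral_congr_ae (.of_forall fun q => by ring)

theorem Sset_subset_neg (ρ : ℝ) (m d : ℕ) : Sset ρ m d ⊆ Sset (-ρ) m d := by
  rintro _ ⟨f, g, hf, hg, rfl⟩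
  refine ⟨fun x => f (-x), g, ⟨hf.1.comp measurable_neg, fun x => hf.2 _⟩, hg, ?_⟩
  ext i j
  refine ((measurePreserving_gauss_neg d).integral_comp (Homeomorph.neg _).measurableEmbedding
    _).symm.trans ?_
  simp [OU, Cmat]

theorem Sset_neg (ρ : ℝ) (m d : ℕ) : Sset (-ρ) m d = Sset ρ m d :=
  Subset.antisymm (by simpa using Sset_subset_neg (-ρ) m d) (Sset_subset_neg ρ m d)

theorem neg_mem_upperInt {t : EReal} {x : ℝ} : -x ∈ upperInt t ↔ x ∈ lowerInt t := by
  change -t < ((-x : ℝ) : EReal) ↔ (x : EReal) < t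
  rw [EReal.coe_neg, EReal.neg_lt_neg_iff]

theorem borellLower_neg (ρ : ℝ) (ta tb : EReal) :
    borellLower (-ρ) ta tb = borellUpper ρ ta tb := by
  have h : MeasurePreserving (fun x : ℝ => -x) gauss1R gauss1R :=
    ⟨measurable_neg, by simpa [gauss1R_eq] using gaussianReal_map_neg (μ := 0) (v := 1)⟩
  refine (h.integral_comp (Homeomorph.neg _).measurableEmbedding _).symm.trans ?_
  refine integral_congr_ae (.of_forall fun x => ?_)
  by_cases hx : x ∈ lowerInt ta
  · simp [OU1, hx, neg_mem_upperInt.2 hx]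
  · simp [hx, mt neg_mem_upperInt.1 hx]

theorem borellUpper_neg (ρ : ℝ) (ta tb : EReal) :
    borellUpper (-ρ) ta tb = borellLower ρ ta tb := by
  rw [← borellLower_neg, neg_neg]


theorem sset_two_characterization_via_borell (d : ℕ) (hd : 1 ≤ d) (ρ : ℝ) :
    (0 < ρ → ρ < 1 →
      Sset ρ 2 d = { M : Matrix (Fin 2) (Fin 2) ℝ |
        ∃ (a b c : ℝ) (ta tb : EReal), a ∈ Set.Icc (0 : ℝ) 1 ∧ b ∈ Set.Icc (0 : ℝ) 1 ∧
          Phi ta = a ∧ Phi tb = b ∧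
          borellLower ρ ta tb ≤ c ∧ c ≤ borellUpper ρ ta tb ∧
          M = Matrix.of !![c, a - c; b - c, 1 - a - b + c] }) ∧
    (-1 < ρ → ρ < 0 →
      Sset ρ 2 d = { M : Matrix (Fin 2) (Fin 2) ℝ |
        ∃ (a b c : ℝ) (ta tb : EReal), a ∈ Set.Icc (0 : ℝ) 1 ∧ b ∈ Set.Icc (0 : ℝ) 1 ∧
          Phi ta = a ∧ Phi tb = b ∧
          borellUpper ρ ta tb ≤ c ∧ c ≤ borellLower ρ ta tb ∧
          M = Matrix.of !![c, a - c; b - c, 1 - a - b + c] }) := by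
  refine ⟨Sset_two_eq hd, fun h1 h0 => ?_⟩
  rw [← Sset_neg, Sset_two_eq hd (neg_pos.2 h0) (by linarith)]
  simp only [borellLower_neg, borellUpper_neg]
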